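/- Σ_ι[λ] = {x ∈ X+ ⊗ t_λ ⊗ X− : x* is extremal}. -/

import Mathlib

open Filter Function

namespace HypCrystal

variable (a1 a2 k1 k2 : ℤ)

/-- `i_k`: 1 if `k` is odd, 2 if `k` is even. -/
def idx (k : ℤ) : ℤ := if k % 2 = 1 then 1 else 2

/-- membership in the index set `I = {1,2}`. -/
def IsI (i : ℤ) : Prop := i = 1 ∨ i = 2

/-- `⟨α_{i_j}, α_{i_k}^∨⟩`. -/
def pairJK (j k : ℤ) : ℤ :=
  if j % 2 = k % 2 then 2 else if k % 2 = 1 then -a1 else -a2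

/-- `⟨α_{i_j}, α_i^∨⟩` for `i ∈ {1,2}`. -/
def pairJI (j i : ℤ) : ℤ :=
  if idx j = i then 2 else if i = 1 then -a1 else -a2

/-- `α_{i_j}` in the `(Λ1, Λ2)`-coordinates. -/
def alphaOf (j : ℤ) : ℤ × ℤ := if j % 2 = 1 then (2, -a2) else (-a1, 2)

/-- `⟨ν, α_i^∨⟩` for a weight `ν` in `(Λ1, Λ2)`-coordinates. -/
def pairW (ν : ℤ × ℤ) (i : ℤ) : ℤ := if i = 1 then ν.1 else ν.2

/-- the sequence `c_j`. -/
def cseq : ℕ → ℤ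
  | 0 => 0
  | 1 => 1
  | j + 2 => (if j % 2 = 0 then a1 else a2) * cseq (j + 1) - cseq j

/-- the sequence `c'_j`. -/
def cseq' : ℕ → ℤ
  | 0 => 0
  | 1 => 1
  | j + 2 => (if j % 2 = 0 then a2 else a1) * cseq' (j + 1) - cseq' j

noncomputable def alphaR : ℝ :=
  ((a1 : ℝ) * a2 + Real.sqrt ((a1 : ℝ) ^ 2 * (a2 : ℝ) ^ 2 - 4 * a1 * a2)) / (2 * a2)

noncomputable def betaR : ℝ :=
  ((a1 : ℝ) * a2 + Real.sqrt ((a1 : ℝ) ^ 2 * (a2 : ℝ) ^ 2 - 4 * a1 * a2)) / (2 * a1)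

/-- `γ_k = α` if `k` even, `β` if `k` odd. -/
noncomputable def gammaR (k : ℤ) : ℝ := if k % 2 = 0 then alphaR a1 a2 else betaR a1 a2

/-- `p_m` for `m ≥ 0`. -/
def ppos : ℕ → ℤ
  | 0 => k2
  | 1 => k1
  | m + 2 => (if m % 2 = 0 then a2 else a1) * ppos (m + 1) - ppos m

/-- `p_{-n}` for `n ≥ 0`. -/
def pneg : ℕ → ℤ
  | 0 => k2
  | 1 => a1 * k2 - k1
  | n + 2 => (if (n + 2) % 2 = 0 then a2 else a1) * pneg (n + 1) - pneg n

/-- the two-sided sequence `p_m`, `m ∈ ℤ`, with `p_0 = k2`, `p_1 = k1`. -/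
def pseq (m : ℤ) : ℤ :=
  if 0 ≤ m then ppos a1 a2 k1 k2 m.toNat else pneg a1 a2 k1 k2 (-m).toNat

/-- `λ = k1·Λ1 − k2·Λ2` in `(Λ1, Λ2)`-coordinates. -/
def lamW : ℤ × ℤ := (k1, -k2)

/-- membership in `ℤ^{+∞}` (coordinates supported on positions `≥ 1`, nonnegative,
finitely supported). -/
def ZPlusMem (x : ℤ → ℤ) : Prop :=
  (∀ k : ℤ, k ≤ 0 → x k = 0) ∧ (∀ k : ℤ, 0 ≤ x k) ∧ ∃ N : ℕ, ∀ k : ℤ, (N : ℤ) < k → x k = 0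

/-- membership in `ℤ^{−∞}` (coordinates supported on positions `≤ 0`, nonpositive,
finitely supported). -/
def ZMinusMem (x : ℤ → ℤ) : Prop :=
  (∀ k : ℤ, 1 ≤ k → x k = 0) ∧ (∀ k : ℤ, x k ≤ 0) ∧ ∃ N : ℕ, ∀ k : ℤ, k < -(N : ℤ) → x k = 0

/-- membership in `X+ = Img(Ψ⁺)`. -/
def XPlusMem (x : ℤ → ℤ) : Prop :=
  ZPlusMem x ∧ ∀ j : ℤ, 1 ≤ j →
    0 ≤ cseq a1 a2 j.toNat * x j - cseq a1 a2 (j - 1).toNat * x (j + 1)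

/-- membership in `X− = Img(Ψ⁻)`. -/
def XMinusMem (x : ℤ → ℤ) : Prop :=
  ZMinusMem x ∧ ∀ j : ℤ, j ≤ 0 →
    cseq' a1 a2 (1 - j).toNat * x j - cseq' a1 a2 (-j).toNat * x (j - 1) ≤ 0

def posPart (x : ℤ → ℤ) : ℤ → ℤ := fun k => if 1 ≤ k then x k else 0
def negPart (x : ℤ → ℤ) : ℤ → ℤ := fun k => if k ≤ 0 then x k else 0

/-- membership in `Z_ι(μ) = ℤ^{+∞} ⊗ t_μ ⊗ ℤ^{−∞}` (in coordinates). -/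
def ZMem (x : ℤ → ℤ) : Prop := ZPlusMem (posPart x) ∧ ZMinusMem (negPart x)

/-- membership in `X+ ⊗ t_λ ⊗ X−` (in coordinates). -/
def XXMem (x : ℤ → ℤ) : Prop := XPlusMem a1 a2 (posPart x) ∧ XMinusMem a1 a2 (negPart x)

/-- `σ_k` on `ℤ^{+∞}` (for `k ≥ 1`). -/
noncomputable def sigmaP (x : ℤ → ℤ) (k : ℤ) : ℤ :=
  x k + ∑ᶠ j : ℤ, if k < j then pairJK a1 a2 j k * x j else 0

/-- `σ_k` on `ℤ^{−∞}` (for `k ≤ 0`). -/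
noncomputable def sigmaM (x : ℤ → ℤ) (k : ℤ) : ℤ :=
  -(x k) - ∑ᶠ j : ℤ, if j < k then pairJK a1 a2 j k * x j else 0

/-- `−Σ_j x_j α_{i_j}` in `(Λ1, Λ2)`-coordinates. -/
noncomputable def wtOf (x : ℤ → ℤ) : ℤ × ℤ :=
  (-∑ᶠ j : ℤ, x j * (alphaOf a1 a2 j).1, -∑ᶠ j : ℤ, x j * (alphaOf a1 a2 j).2)

/-- `wt(x) = μ − Σ_j x_j α_{i_j}`. -/
noncomputable def wtZ (μ : ℤ × ℤ) (x : ℤ → ℤ) : ℤ × ℤ := μ + wtOf a1 a2 x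

/-- `σ_k` on `Z_ι(μ)`. -/
noncomputable def sigmaZ (μ : ℤ × ℤ) (x : ℤ → ℤ) (k : ℤ) : ℤ :=
  if 1 ≤ k then sigmaP a1 a2 x k
  else sigmaM a1 a2 x k - pairW (wtZ a1 a2 μ x) (idx k)

/-- `ε_i` on `Z_ι(μ)`. -/
noncomputable def epsZ (μ : ℤ × ℤ) (x : ℤ → ℤ) (i : ℤ) : ℤ :=
  sSup {s : ℤ | ∃ k : ℤ, idx k = i ∧ sigmaZ a1 a2 μ x k = s}

/-- `φ_i` on `Z_ι(μ)`. -/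
noncomputable def phiZ (μ : ℤ × ℤ) (x : ℤ → ℤ) (i : ℤ) : ℤ :=
  epsZ a1 a2 μ x i + pairW (wtZ a1 a2 μ x) i

noncomputable def kmaxZ (μ : ℤ × ℤ) (x : ℤ → ℤ) (i : ℤ) : ℤ :=
  sSup {k : ℤ | idx k = i ∧ sigmaZ a1 a2 μ x k = epsZ a1 a2 μ x i}

noncomputable def kminZ (μ : ℤ × ℤ) (x : ℤ → ℤ) (i : ℤ) : ℤ :=
  sInf {k : ℤ | idx k = i ∧ sigmaZ a1 a2 μ x k = epsZ a1 a2 μ x i}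

/-- `ẽ_i` on `Z_ι(μ)`; `none` represents `0`. -/
noncomputable def eZ (μ : ℤ × ℤ) (i : ℤ) (x : ℤ → ℤ) : Option (ℤ → ℤ) :=
  if 0 < epsZ a1 a2 μ x i then
    some (Function.update x (kmaxZ a1 a2 μ x i) (x (kmaxZ a1 a2 μ x i) - 1))
  else none

/-- `f̃_i` on `Z_ι(μ)`; `none` represents `0`. -/
noncomputable def fZ (μ : ℤ × ℤ) (i : ℤ) (x : ℤ → ℤ) : Option (ℤ → ℤ) :=
  if 0 < phiZ a1 a2 μ x i then
    some (Function.update x (kminZ a1 a2 μ x i) (x (kminZ a1 a2 μ x i) + 1))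
  else none

/-- `ε_i` on `ℤ^{+∞}`. -/
noncomputable def epsP (x : ℤ → ℤ) (i : ℤ) : ℤ :=
  sSup {s : ℤ | ∃ k : ℤ, 1 ≤ k ∧ idx k = i ∧ sigmaP a1 a2 x k = s}

noncomputable def kmaxP (x : ℤ → ℤ) (i : ℤ) : ℤ :=
  sSup {k : ℤ | 1 ≤ k ∧ idx k = i ∧ sigmaP a1 a2 x k = epsP a1 a2 x i}

noncomputable def kminP (x : ℤ → ℤ) (i : ℤ) : ℤ :=
  sInf {k : ℤ | 1 ≤ k ∧ idx k = i ∧ sigmaP a1 a2 x k = epsP a1 a2 x i}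

/-- `ẽ_i` on `ℤ^{+∞}` (partial). -/
noncomputable def eP (i : ℤ) (x : ℤ → ℤ) : Option (ℤ → ℤ) :=
  if 0 < epsP a1 a2 x i then
    some (Function.update x (kmaxP a1 a2 x i) (x (kmaxP a1 a2 x i) - 1))
  else none

/-- `f̃_i` on `ℤ^{+∞}` (total). -/
noncomputable def fP (i : ℤ) (x : ℤ → ℤ) : ℤ → ℤ :=
  Function.update x (kminP a1 a2 x i) (x (kminP a1 a2 x i) + 1)

/-- `φ_i` on `ℤ^{−∞}`. -/
noncomputable def phiMf (x : ℤ → ℤ) (i : ℤ) : ℤ :=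
  sSup {s : ℤ | ∃ k : ℤ, k ≤ 0 ∧ idx k = i ∧ sigmaM a1 a2 x k = s}

noncomputable def kmaxM (x : ℤ → ℤ) (i : ℤ) : ℤ :=
  sSup {k : ℤ | k ≤ 0 ∧ idx k = i ∧ sigmaM a1 a2 x k = phiMf a1 a2 x i}

noncomputable def kminM (x : ℤ → ℤ) (i : ℤ) : ℤ :=
  sInf {k : ℤ | k ≤ 0 ∧ idx k = i ∧ sigmaM a1 a2 x k = phiMf a1 a2 x i}

/-- `ẽ_i` on `ℤ^{−∞}` (total). -/
noncomputable def eM (i : ℤ) (x : ℤ → ℤ) : ℤ → ℤ :=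
  Function.update x (kmaxM a1 a2 x i) (x (kmaxM a1 a2 x i) - 1)

noncomputable def fPiter (i : ℤ) (n : ℕ) (x : ℤ → ℤ) : ℤ → ℤ := (fP a1 a2 i)^[n] x

noncomputable def eMiter (i : ℤ) (n : ℕ) (x : ℤ → ℤ) : ℤ → ℤ := (eM a1 a2 i)^[n] x

noncomputable def ePiterO (i : ℤ) (n : ℕ) (ox : Option (ℤ → ℤ)) : Option (ℤ → ℤ) :=
  (fun o => o.bind (eP a1 a2 i))^[n] ox

noncomputable def eZiterO (μ : ℤ × ℤ) (i : ℤ) (n : ℕ) (ox : Option (ℤ → ℤ)) : Option (ℤ → ℤ) :=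
  (fun o => o.bind (eZ a1 a2 μ i))^[n] ox

noncomputable def fZiterO (μ : ℤ × ℤ) (i : ℤ) (n : ℕ) (ox : Option (ℤ → ℤ)) : Option (ℤ → ℤ) :=
  (fun o => o.bind (fZ a1 a2 μ i))^[n] ox

noncomputable def suppBoundP (x : ℤ → ℤ) : ℕ := sInf {N : ℕ | ∀ k : ℤ, (N : ℤ) < k → x k = 0}

noncomputable def suppBoundM (x : ℤ → ℤ) : ℕ := sInf {N : ℕ | ∀ k : ℤ, k < -(N : ℤ) → x k = 0}

/-- `starPChain x n z = f̃_{i_1}^{x_1} ⋯ f̃_{i_n}^{x_n} (z)` on `ℤ^{+∞}`. -/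
noncomputable def starPChain (x : ℤ → ℤ) : ℕ → (ℤ → ℤ) → (ℤ → ℤ)
  | 0, z => z
  | n + 1, z => starPChain x n (fPiter a1 a2 (idx ((n : ℤ) + 1)) ((x ((n : ℤ) + 1)).toNat) z)

/-- the `∗`-operation on `X+`: `(x⁺)* = f̃_{i_1}^{x_1} ⋯ f̃_{i_N}^{x_N} (z_∞)`. -/
noncomputable def starP (x : ℤ → ℤ) : ℤ → ℤ :=
  starPChain a1 a2 x (suppBoundP x) (fun _ => 0)

/-- `starMChain x n z = ẽ_{i_0}^{−x_0} ⋯ ẽ_{i_{-(n-1)}}^{−x_{-(n-1)}} (z)` on `ℤ^{−∞}`. -/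
noncomputable def starMChain (x : ℤ → ℤ) : ℕ → (ℤ → ℤ) → (ℤ → ℤ)
  | 0, z => z
  | n + 1, z => starMChain x n (eMiter a1 a2 (idx (-(n : ℤ))) ((-(x (-(n : ℤ)))).toNat) z)

/-- the `∗`-operation on `X−`. -/
noncomputable def starM (x : ℤ → ℤ) : ℤ → ℤ :=
  starMChain a1 a2 x (suppBoundM x + 1) (fun _ => 0)

/-- combine a `ℤ^{+∞}`- and a `ℤ^{−∞}`-component into an element of `Z_ι(μ)`. -/
def combine (y z : ℤ → ℤ) : ℤ → ℤ := fun k => if 1 ≤ k then y k else z k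

/-- the coordinates of `x* = (x⁺)* ⊗ t_μ ⊗ (x⁻)*`. -/
noncomputable def xstarFun (x : ℤ → ℤ) : ℤ → ℤ :=
  combine (starP a1 a2 (posPart x)) (starM a1 a2 (negPart x))

/-- the weight `μ = −λ − wt(x⁺) − wt(x⁻)` of `x*`. -/
noncomputable def mustar (lam : ℤ × ℤ) (x : ℤ → ℤ) : ℤ × ℤ :=
  -lam - wtOf a1 a2 (posPart x) - wtOf a1 a2 (negPart x)

/-- `fPnegChain g n z = f̃_{i_{-(n-1)}}^{g(-(n-1))} ⋯ f̃_{i_{-1}}^{g(-1)} f̃_{i_0}^{g 0} (z)`. -/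
noncomputable def fPnegChain (g : ℤ → ℕ) : ℕ → (ℤ → ℤ) → (ℤ → ℤ)
  | 0, z => z
  | n + 1, z => fPiter a1 a2 (idx (-(n : ℤ))) (g (-(n : ℤ))) (fPnegChain g n z)

/-- `eMposChain g n z = ẽ_{i_n}^{g n} ⋯ ẽ_{i_2}^{g 2} ẽ_{i_1}^{g 1} (z)`. -/
noncomputable def eMposChain (g : ℤ → ℕ) : ℕ → (ℤ → ℤ) → (ℤ → ℤ)
  | 0, z => z
  | n + 1, z => eMiter a1 a2 (idx ((n : ℤ) + 1)) (g ((n : ℤ) + 1)) (eMposChain g n z)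

/-- `ePposChainO g n z = ẽ_{i_n}^{g n} ⋯ ẽ_{i_2}^{g 2} ẽ_{i_1}^{g 1} (z)` on `ℤ^{+∞}`. -/
noncomputable def ePposChainO (g : ℤ → ℕ) : ℕ → Option (ℤ → ℤ) → Option (ℤ → ℤ)
  | 0, z => z
  | n + 1, z => ePiterO a1 a2 (idx ((n : ℤ) + 1)) (g ((n : ℤ) + 1)) (ePposChainO g n z)

/-- the Weyl group action `S_i` on `Z_ι(μ) ∪ {0}`. -/
noncomputable def SiO (μ : ℤ × ℤ) (i : ℤ) (ob : Option (ℤ → ℤ)) : Option (ℤ → ℤ) :=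
  ob.bind fun b =>
    if 0 ≤ pairW (wtZ a1 a2 μ b) i then
      fZiterO a1 a2 μ i (pairW (wtZ a1 a2 μ b) i).toNat (some b)
    else eZiterO a1 a2 μ i (-(pairW (wtZ a1 a2 μ b) i)).toNat (some b)

/-- `SwPos μ n = S_{i_n} ⋯ S_{i_2} S_{i_1}`. -/
noncomputable def SwPos (μ : ℤ × ℤ) : ℕ → Option (ℤ → ℤ) → Option (ℤ → ℤ)
  | 0, b => b
  | n + 1, b => SiO a1 a2 μ (idx ((n : ℤ) + 1)) (SwPos μ n b)

/-- `SwNeg μ n = S_{i_{-(n-1)}} ⋯ S_{i_{-1}} S_{i_0}`. -/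
noncomputable def SwNeg (μ : ℤ × ℤ) : ℕ → Option (ℤ → ℤ) → Option (ℤ → ℤ)
  | 0, b => b
  | n + 1, b => SiO a1 a2 μ (idx (-(n : ℤ))) (SwNeg μ n b)

/-- `S_{w_k}`. -/
noncomputable def Swk (μ : ℤ × ℤ) (k : ℤ) (b : Option (ℤ → ℤ)) : Option (ℤ → ℤ) :=
  if 0 ≤ k then SwPos a1 a2 μ k.toNat b else SwNeg a1 a2 μ (-k).toNat b

/-- `b ∈ Z_ι(μ)` is extremal. -/
noncomputable def Extremal (μ : ℤ × ℤ) (b : ℤ → ℤ) : Prop :=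
  ∀ js : List ℤ, (∀ j ∈ js, IsI j) →
    ∃ b', js.foldr (SiO a1 a2 μ) (some b) = some b' ∧
      ∀ i : ℤ, IsI i →
        (0 ≤ pairW (wtZ a1 a2 μ b') i → eZ a1 a2 μ i b' = none) ∧
        (pairW (wtZ a1 a2 μ b') i ≤ 0 → fZ a1 a2 μ i b' = none)

/-- `φ(x) ≥ 0` for all `φ ∈ Ξ_ι[λ]`. -/
noncomputable def SigmaCond (x : ℤ → ℤ) : Prop :=
  (0 ≤ gammaR a1 a2 0 * (pseq a1 a2 k1 k2 0 : ℝ) + gammaR a1 a2 0 * (x 0 : ℝ) - (x 1 : ℝ)) ∧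
  (0 ≤ gammaR a1 a2 1 * (pseq a1 a2 k1 k2 1 : ℝ) + (x 0 : ℝ) - gammaR a1 a2 1 * (x 1 : ℝ)) ∧
  (∀ k : ℤ, 1 ≤ k → 0 ≤ (pseq a1 a2 k1 k2 k : ℝ) - (x k : ℝ)) ∧
  (∀ k : ℤ, 1 ≤ k → 0 ≤ gammaR a1 a2 k * (x k : ℝ) - (x (k + 1) : ℝ)) ∧
  (∀ k : ℤ, 1 ≤ k → 0 ≤ gammaR a1 a2 (k + 1) * (pseq a1 a2 k1 k2 (k + 1) : ℝ) -
      (pseq a1 a2 k1 k2 k : ℝ) + (x k : ℝ) - gammaR a1 a2 (k + 1) * (x (k + 1) : ℝ)) ∧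
  (∀ k : ℤ, k ≤ 0 → 0 ≤ (pseq a1 a2 k1 k2 k : ℝ) + (x k : ℝ)) ∧
  (∀ k : ℤ, k ≤ 0 → 0 ≤ (x (k - 1) : ℝ) - gammaR a1 a2 k * (x k : ℝ)) ∧
  (∀ k : ℤ, k ≤ 0 → 0 ≤ gammaR a1 a2 (k - 1) * (pseq a1 a2 k1 k2 (k - 1) : ℝ) -
      (pseq a1 a2 k1 k2 k : ℝ) + gammaR a1 a2 (k - 1) * (x (k - 1) : ℝ) - (x k : ℝ))

/-- membership in `Σ_ι[λ]`. -/
noncomputable def SigmaMem (x : ℤ → ℤ) : Prop :=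
  ZMem x ∧ SigmaCond a1 a2 k1 k2 x

/-- membership in `Σ'_ι[λ]`. -/
noncomputable def SigmaPrimeMem (x : ℤ → ℤ) : Prop :=
  SigmaMem a1 a2 k1 k2 x ∧ (∀ k : ℤ, k ≤ 0 → x k = 0) ∧ XPlusMem a1 a2 (posPart x)

/-- evaluation of an affine function `φ = (c, (φ_l)_l)` at `x`. -/
noncomputable def evalAff (φ : ℝ × (ℤ → ℝ)) (x : ℤ → ℤ) : ℝ :=
  φ.1 + ∑ᶠ l : ℤ, φ.2 l * (x l : ℝ)

/-- `a_{i_k}`. -/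
def aIdx (k : ℤ) : ℤ := if k % 2 = 1 then a1 else a2

/-- the affine function `b̄_k`. -/
noncomputable def bbar (lam : ℤ × ℤ) (k : ℤ) : ℝ × (ℤ → ℝ) :=
  ((if k = -1 ∨ k = 0 then -(pairW lam (idx k) : ℝ) else 0),
    fun l => (if l = k then (1 : ℝ) else 0) + (if l = k + 1 then -(aIdx a1 a2 k : ℝ) else 0) +
      (if l = k + 2 then (1 : ℝ) else 0))

/-- the operator `S̄_k` on affine functions. -/
noncomputable def SbarOp (lam : ℤ × ℤ) (k : ℤ) (φ : ℝ × (ℤ → ℝ)) : ℝ × (ℤ → ℝ) :=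
  let b := if 0 ≤ φ.2 k then bbar a1 a2 lam (k + 2) else bbar a1 a2 lam (k - 2)
  (φ.1 - φ.2 k * b.1, fun l => φ.2 l - φ.2 k * b.2 l)

end HypCrystal

namespace HypCrystal

/-! ### Index bookkeeping and finite support -/

lemma idx_eq_iff (j k : ℤ) : idx j = idx k ↔ j % 2 = k % 2 := by
  unfold idx; split_ifs <;> omega

lemma isI_idx (k : ℤ) : IsI (idx k) := by
  unfold IsI idx; split_ifs <;> simp

lemma exists_idx_eq {i : ℤ} (hi : IsI i) (N : ℤ) : ∃ k, N < k ∧ idx k = i := by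
  rcases hi with rfl | rfl
  · exact ⟨2 * |N| + 1, by have := le_abs_self N; have := abs_nonneg N; omega,
      by unfold idx; rw [if_pos (by omega)]⟩
  · exact ⟨2 * |N| + 2, by have := le_abs_self N; have := abs_nonneg N; omega,
      by unfold idx; rw [if_neg (by omega)]⟩

lemma pairJK_of_idx_eq (a1 a2 : ℤ) {j k : ℤ} (h : idx j = idx k) : pairJK a1 a2 j k = 2 :=
  if_pos ((idx_eq_iff j k).1 h)

lemma pairJK_of_idx_ne (a1 a2 : ℤ) {j k : ℤ} (h : idx j ≠ idx k) :
    pairJK a1 a2 j k = -aIdx a1 a2 k := by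
  have h' : ¬ j % 2 = k % 2 := fun h' => h ((idx_eq_iff j k).2 h')
  unfold pairJK aIdx
  rw [if_neg h']; split_ifs <;> rfl

/-- Integer sequences supported on a finite set of positions `≥ 1`. -/
def FinP (y : ℤ → ℤ) : Prop := (∀ k ≤ 0, y k = 0) ∧ ∃ N : ℤ, ∀ k, N < k → y k = 0

/-- Integer sequences supported on a finite set of positions `≤ 0`. -/
def FinM (z : ℤ → ℤ) : Prop := (∀ k, 1 ≤ k → z k = 0) ∧ ∃ N : ℤ, ∀ k, k < N → z k = 0

lemma FinP.finite_support {y : ℤ → ℤ} (hy : FinP y) : (support y).Finite := by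
  obtain ⟨h0, N, hN⟩ := hy
  refine (Set.finite_Icc 0 N).subset fun k hk => ⟨?_, ?_⟩
  · by_contra h; exact hk (h0 k (by omega))
  · by_contra h; exact hk (hN k (by omega))

lemma FinM.finite_support {z : ℤ → ℤ} (hz : FinM z) : (support z).Finite := by
  obtain ⟨h0, N, hN⟩ := hz
  refine (Set.finite_Icc N 0).subset fun k hk => ⟨?_, ?_⟩
  · by_contra h; exact hk (hN k (by omega))
  · by_contra h; exact hk (h0 k (by omega))

lemma FinP.update {y : ℤ → ℤ} (hy : FinP y) {k : ℤ} (hk : 1 ≤ k) (v : ℤ) :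
    FinP (update y k v) := by
  obtain ⟨h0, N, hN⟩ := hy
  refine ⟨fun j hj => ?_, max N k, fun j hj => ?_⟩
  · rw [update_of_ne (by omega)]; exact h0 j hj
  · rw [update_of_ne (by have := le_max_right N k; omega)]
    exact hN j (lt_of_le_of_lt (le_max_left _ _) hj)

lemma finP_zero : FinP (fun _ => 0) := ⟨fun _ _ => rfl, 0, fun _ _ => rfl⟩

/-! ### Effect of changing one coordinate -/

lemma finsum_mul_update {y : ℤ → ℤ} (hy : (support y).Finite) (w : ℤ → ℤ) (k₀ v : ℤ) :
    ∑ᶠ j, w j * update y k₀ (y k₀ + v) j = ∑ᶠ j, w j * y j + w k₀ * v := by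
  have h1 : ∀ j, w j * update y k₀ (y k₀ + v) j = w j * y j + (if j = k₀ then w k₀ * v else 0) := by
    intro j
    by_cases h : j = k₀
    · subst h; simp; ring
    · simp [h]
  simp_rw [h1]
  rw [finsum_add_distrib]
  · congr 1
    rw [finsum_eq_single _ k₀ (fun j hj => if_neg hj), if_pos rfl]
  · exact hy.subset fun j hj h => hj (by simp [h])
  · exact (Set.finite_singleton k₀).subset fun j hj => by
      by_contra h; exact hj (if_neg h)

lemma sigmaP_eq (a1 a2 : ℤ) (y : ℤ → ℤ) (k : ℤ) :
    sigmaP a1 a2 y k = y k + ∑ᶠ j, (if k < j then pairJK a1 a2 j k else 0) * y j := by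
  unfold sigmaP
  congr 1
  exact finsum_congr fun j => by split_ifs <;> simp

lemma sigmaP_update (a1 a2 : ℤ) {y : ℤ → ℤ} (hy : (support y).Finite) (k₀ v k : ℤ) :
    sigmaP a1 a2 (update y k₀ (y k₀ + v)) k =
      sigmaP a1 a2 y k + (if k = k₀ then v else 0) +
        (if k < k₀ then pairJK a1 a2 k₀ k else 0) * v := by
  rw [sigmaP_eq, sigmaP_eq, finsum_mul_update hy]
  by_cases h : k = k₀
  · subst h; simp; ring
  · simp [h]; ring

lemma wtOf_update (a1 a2 : ℤ) {y : ℤ → ℤ} (hy : (support y).Finite) (k₀ v : ℤ) :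
    wtOf a1 a2 (update y k₀ (y k₀ + v)) = wtOf a1 a2 y - v • alphaOf a1 a2 k₀ := by
  unfold wtOf
  simp_rw [mul_comm _ (alphaOf a1 a2 _).1, mul_comm _ (alphaOf a1 a2 _).2]
  rw [finsum_mul_update hy, finsum_mul_update hy]
  ext <;> simp <;> ring

lemma alphaOf_congr (a1 a2 : ℤ) {j k : ℤ} (h : idx j = idx k) :
    alphaOf a1 a2 j = alphaOf a1 a2 k := by
  unfold alphaOf; rw [(idx_eq_iff j k).1 h]

lemma pairW_alphaOf_self (a1 a2 k : ℤ) : pairW (alphaOf a1 a2 k) (idx k) = 2 := by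
  unfold pairW alphaOf idx; split_ifs <;> simp_all

lemma pairW_alphaOf_succ (a1 a2 k : ℤ) :
    pairW (alphaOf a1 a2 (k + 1)) (idx k) = -aIdx a1 a2 k := by
  unfold pairW alphaOf idx aIdx; split_ifs <;> omega

lemma pairW_add (μ ν : ℤ × ℤ) (i : ℤ) : pairW (μ + ν) i = pairW μ i + pairW ν i := by
  unfold pairW; split_ifs <;> simp

lemma pairW_zsmul (n : ℤ) (ν : ℤ × ℤ) (i : ℤ) : pairW (n • ν) i = n * pairW ν i := by
  unfold pairW; split_ifs <;> simp

/-! ### The crystal `ℤ^{+∞}` -/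

lemma sigmaP_zero (a1 a2 k : ℤ) : sigmaP a1 a2 (fun _ => 0) k = 0 := by
  simp [sigmaP]

lemma sigmaP_far (a1 a2 : ℤ) {y : ℤ → ℤ} {N k : ℤ} (hN : ∀ k, N < k → y k = 0) (hk : N < k) :
    sigmaP a1 a2 y k = 0 := by
  rw [sigmaP_eq, hN k hk, zero_add]
  rw [finsum_congr (g := fun _ => (0 : ℤ)), finsum_zero]
  intro j
  split_ifs with h
  · rw [hN j (by omega), mul_zero]
  · simp

lemma epsP_isGreatest (a1 a2 : ℤ) {y : ℤ → ℤ} (hy : FinP y) {i : ℤ} (hi : IsI i) :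
    IsGreatest {s : ℤ | ∃ k : ℤ, 1 ≤ k ∧ idx k = i ∧ sigmaP a1 a2 y k = s} (epsP a1 a2 y i) := by
  obtain ⟨-, N, hN⟩ := hy
  have hne : {s : ℤ | ∃ k : ℤ, 1 ≤ k ∧ idx k = i ∧ sigmaP a1 a2 y k = s}.Nonempty := by
    obtain ⟨k, hk, hki⟩ := exists_idx_eq hi 0
    exact ⟨_, k, by omega, hki, rfl⟩
  have hfin : {s : ℤ | ∃ k : ℤ, 1 ≤ k ∧ idx k = i ∧ sigmaP a1 a2 y k = s}.Finite := by
    refine (((Set.finite_Icc 1 N).image (sigmaP a1 a2 y)).insert 0).subset ?_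
    rintro s ⟨k, hk, -, rfl⟩
    rcases lt_or_ge N k with h | h
    · left; exact sigmaP_far a1 a2 hN h
    · right; exact ⟨k, ⟨hk, h⟩, rfl⟩
  exact ⟨Int.csSup_mem hne hfin.bddAbove, fun s hs => le_csSup hfin.bddAbove hs⟩

lemma sigmaP_le_epsP (a1 a2 : ℤ) {y : ℤ → ℤ} (hy : FinP y) {k : ℤ} (hk : 1 ≤ k) :
    sigmaP a1 a2 y k ≤ epsP a1 a2 y (idx k) :=
  (epsP_isGreatest a1 a2 hy (isI_idx k)).2 ⟨k, hk, rfl, rfl⟩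

lemma epsP_nonneg (a1 a2 : ℤ) {y : ℤ → ℤ} (hy : FinP y) {i : ℤ} (hi : IsI i) :
    0 ≤ epsP a1 a2 y i := by
  obtain ⟨-, N, hN⟩ := id hy
  obtain ⟨k, hk, rfl⟩ := exists_idx_eq hi (max 0 N)
  have h1 := le_max_left 0 N
  have h2 := le_max_right 0 N
  rw [← sigmaP_far a1 a2 hN (show N < k by omega)]
  exact sigmaP_le_epsP a1 a2 hy (by omega)

lemma epsP_zero (a1 a2 : ℤ) {i : ℤ} (hi : IsI i) : epsP a1 a2 (fun _ => 0) i = 0 := by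
  obtain ⟨k, -, -, h⟩ := (epsP_isGreatest a1 a2 finP_zero hi).1
  rw [← h, sigmaP_zero]

lemma kminP_isLeast (a1 a2 : ℤ) {y : ℤ → ℤ} (hy : FinP y) {i : ℤ} (hi : IsI i) :
    IsLeast {k : ℤ | 1 ≤ k ∧ idx k = i ∧ sigmaP a1 a2 y k = epsP a1 a2 y i}
      (kminP a1 a2 y i) := by
  have hb : BddBelow {k : ℤ | 1 ≤ k ∧ idx k = i ∧ sigmaP a1 a2 y k = epsP a1 a2 y i} :=
    ⟨1, fun k hk => hk.1⟩
  exact ⟨Int.csInf_mem (epsP_isGreatest a1 a2 hy hi).1 hb, fun s hs => csInf_le hb hs⟩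

lemma FinP.fP (a1 a2 : ℤ) {y : ℤ → ℤ} (hy : FinP y) {i : ℤ} (hi : IsI i) :
    FinP (fP a1 a2 i y) :=
  hy.update (kminP_isLeast a1 a2 hy hi).1.1 _

lemma fPiter_succ (a1 a2 i : ℤ) (n : ℕ) (y : ℤ → ℤ) :
    fPiter a1 a2 i (n + 1) y = fP a1 a2 i (fPiter a1 a2 i n y) :=
  iterate_succ_apply' _ _ _

lemma fPiter_zero (a1 a2 i : ℤ) (y : ℤ → ℤ) : fPiter a1 a2 i 0 y = y := rfl

lemma FinP.fPiter (a1 a2 : ℤ) {y : ℤ → ℤ} (hy : FinP y) {i : ℤ} (hi : IsI i) (n : ℕ) :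
    FinP (fPiter a1 a2 i n y) := by
  induction n with
  | zero => exact hy
  | succ n ih => rw [fPiter_succ]; exact ih.fP a1 a2 hi

lemma wtOf_fPiter (a1 a2 : ℤ) {y : ℤ → ℤ} (hy : FinP y) (κ : ℤ) (n : ℕ) :
    wtOf a1 a2 (fPiter a1 a2 (idx κ) n y) = wtOf a1 a2 y - (n : ℤ) • alphaOf a1 a2 κ := by
  induction n with
  | zero => simp [fPiter_zero]
  | succ n ih =>
    have hn := hy.fPiter a1 a2 (isI_idx κ) n
    rw [fPiter_succ, fP, wtOf_update a1 a2 hn.finite_support, ih,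
      alphaOf_congr a1 a2 (kminP_isLeast a1 a2 hn (isI_idx κ)).1.2.1]
    push_cast
    rw [add_smul]; abel

/-- `D l` is the amount that `f̃_i^c` adds at the positions `> l`. -/
structure StringProfile (a1 a2 i : ℤ) (y w : ℤ → ℤ) (c : ℤ) (D : ℤ → ℤ) : Prop where
  anti : ∀ l l', l ≤ l' → D l' ≤ D l
  same : ∀ k, 1 ≤ k → idx k = i → sigmaP a1 a2 w k = sigmaP a1 a2 y k + D k + D (k - 1)
  other : ∀ k, 1 ≤ k → idx k ≠ i → sigmaP a1 a2 w k = sigmaP a1 a2 y k - aIdx a1 a2 k * D k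
  le : ∀ l, D l ≤ c
  le_neg : ∀ l j, 1 ≤ j → j ≤ l → idx j = i → D l ≤ -sigmaP a1 a2 y j
  eq_or : ∀ l, D l = c ∨ ∃ j, 1 ≤ j ∧ j ≤ l ∧ idx j = i ∧ D l = -sigmaP a1 a2 y j
  sigma_le : ∀ l k, l < k → 1 ≤ k → idx k = i → sigmaP a1 a2 w k ≤ D l
  sigma_eq : ∀ l, 0 ≤ l → ∃ k, l < k ∧ idx k = i ∧ sigmaP a1 a2 w k = D l

lemma StringProfile.epsP_eq {a1 a2 i c : ℤ} {y w D : ℤ → ℤ}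
    (h : StringProfile a1 a2 i y w c D) : epsP a1 a2 w i = c := by
  have h0 : D 0 = c := by
    rcases h.eq_or 0 with h | ⟨j, h1, h2, -⟩
    · exact h
    · omega
  refine IsGreatest.csSup_eq ⟨?_, ?_⟩
  · obtain ⟨k, hk, hki, hs⟩ := h.sigma_eq 0 le_rfl
    exact ⟨k, by omega, hki, by rw [hs, h0]⟩
  · rintro s ⟨k, hk, hki, rfl⟩
    rw [← h0]; exact h.sigma_le 0 k (by omega) hk hki

lemma exists_stringProfile (a1 a2 : ℤ) {y : ℤ → ℤ} (hy : FinP y) {i : ℤ} (hi : IsI i)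
    (h0 : epsP a1 a2 y i = 0) (c : ℕ) :
    ∃ D, StringProfile a1 a2 i y (fPiter a1 a2 i c y) c D := by
  have hle : ∀ k, 1 ≤ k → idx k = i → sigmaP a1 a2 y k ≤ 0 := by
    rintro k hk rfl; rw [← h0]; exact sigmaP_le_epsP a1 a2 hy hk
  induction c with
  | zero =>
    refine ⟨fun _ => 0, fun _ _ _ => le_rfl, ?_, ?_, ?_, ?_, ?_, ?_, ?_⟩
    · intro k _ _; simp [fPiter_zero]
    · intro k _ _; simp [fPiter_zero]
    · simp
    · intro l j hj _ hji; have := hle j hj hji; omega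
    · intro l; left; simp
    · intro l k _ hk hki; exact hle k hk hki
    · intro l hl
      obtain ⟨-, N, hN⟩ := hy
      obtain ⟨k, hk, hki⟩ := exists_idx_eq hi (max l N)
      have h1 := le_max_left l N
      have h2 := le_max_right l N
      exact ⟨k, by omega, hki, sigmaP_far a1 a2 hN (by omega)⟩
  | succ c ih =>
    obtain ⟨D, hD⟩ := ih
    set w := fPiter a1 a2 i c y with hw
    have hwf : FinP w := hy.fPiter a1 a2 hi c
    have heps := hD.epsP_eq
    obtain ⟨⟨hk1, hki, hks⟩, hkmin⟩ := kminP_isLeast a1 a2 hwf hi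
    rw [fPiter_succ, ← hw, fP]
    set k₀ := kminP a1 a2 w i
    rw [heps] at hks
    have hlt : ∀ k, 1 ≤ k → idx k = i → k < k₀ → sigmaP a1 a2 w k < c := by
      intro k hk hki' hkk
      refine lt_of_le_of_ne ?_ fun h => ?_
      · rw [← heps, ← hki']; exact sigmaP_le_epsP a1 a2 hwf hk
      · have := hkmin ⟨hk, hki', by rw [h, heps]⟩
        omega
    have hDc : ∀ l, l < k₀ → D l = c := fun l hl =>
      le_antisymm (hD.le l) (hks ▸ hD.sigma_le l k₀ hl hk1 hki)
    have hup : ∀ k, sigmaP a1 a2 (update w k₀ (w k₀ + 1)) k = _ := fun k =>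
      sigmaP_update a1 a2 hwf.finite_support k₀ 1 k
    refine ⟨fun l => D l + if l < k₀ then 1 else 0, ?_, ?_, ?_, ?_, ?_, ?_, ?_, ?_⟩
    · intro l l' hl
      have := hD.anti l l' hl
      split_ifs <;> omega
    · intro k hk hki'
      rw [hup, hD.same k hk hki', pairJK_of_idx_eq a1 a2 (hki.trans hki'.symm)]
      split_ifs <;> omega
    · intro k hk hki'
      rw [hup, hD.other k hk hki', pairJK_of_idx_ne a1 a2 (fun h => hki' (h ▸ hki))]
      have : k ≠ k₀ := fun h => hki' (h ▸ hki)
      rw [if_neg this]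
      split_ifs <;> ring
    · intro l
      have := hD.le l
      push_cast; split_ifs <;> omega
    · intro l j hj hjl hji
      have h1 := hD.le_neg l j hj hjl hji
      split_ifs with h
      · have h2 := hlt j hj hji (by omega)
        rw [hD.same j hj hji, hDc j (by omega), hDc (j - 1) (by omega)] at h2
        rw [hDc l h]; omega
      · omega
    · intro l
      split_ifs with h
      · left; rw [hDc l h]; push_cast; rfl
      · right
        rcases hD.eq_or l with h1 | ⟨j, hj, hjl, hji, h1⟩
        · refine ⟨k₀, hk1, by omega, hki, ?_⟩
          have h2 := hD.same k₀ hk1 hki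
          have h3 := hD.anti k₀ l (by omega)
          have h4 := hD.le k₀
          have h5 := hDc (k₀ - 1) (by omega)
          omega
        · exact ⟨j, hj, hjl, hji, by rw [h1]; ring⟩
    · intro l k hlk hk hki'
      rw [hup, pairJK_of_idx_eq a1 a2 (hki.trans hki'.symm)]
      have h1 := hD.sigma_le l k hlk hk hki'
      rcases lt_trichotomy k k₀ with h | h | h
      · have h2 := hlt k hk hki' h
        have h3 := hDc l (by omega)
        split_ifs <;> omega
      · have h3 := hDc l (by omega)
        rw [h] at h1 ⊢
        split_ifs <;> omega
      · split_ifs <;> omega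
    · intro l hl
      by_cases h : l < k₀
      · refine ⟨k₀, h, hki, ?_⟩
        rw [hup, hks]
        simp [h, hDc l h]
      · obtain ⟨k, hk, hki', hs⟩ := hD.sigma_eq l hl
        refine ⟨k, hk, hki', ?_⟩
        rw [hup, hs]
        simp [h, show k ≠ k₀ by omega, show ¬ k < k₀ by omega]

lemma epsP_fPiter (a1 a2 : ℤ) {y : ℤ → ℤ} (hy : FinP y) {i : ℤ} (hi : IsI i)
    (h0 : epsP a1 a2 y i = 0) (c : ℕ) : epsP a1 a2 (fPiter a1 a2 i c y) i = c :=
  (exists_stringProfile a1 a2 hy hi h0 c).choose_spec.epsP_eq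

/-- The position raised by the last `f̃_i` is the one that `ẽ_i` lowers. -/
lemma kminP_fPiter_isGreatest (a1 a2 : ℤ) {y : ℤ → ℤ} (hy : FinP y) {i : ℤ} (hi : IsI i)
    (h0 : epsP a1 a2 y i = 0) (c : ℕ) :
    IsGreatest {k : ℤ | 1 ≤ k ∧ idx k = i ∧ sigmaP a1 a2 (fPiter a1 a2 i (c + 1) y) k = c + 1}
      (kminP a1 a2 (fPiter a1 a2 i c y) i) := by
  have hwf : FinP (fPiter a1 a2 i c y) := hy.fPiter a1 a2 hi c
  have heps := epsP_fPiter a1 a2 hy hi h0 c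
  obtain ⟨⟨hk1, hki, hks⟩, -⟩ := kminP_isLeast a1 a2 hwf hi
  rw [fPiter_succ, fP]
  refine ⟨⟨hk1, hki, ?_⟩, ?_⟩
  · rw [sigmaP_update a1 a2 hwf.finite_support, hks, heps]; simp
  · rintro k ⟨hk, hki', hs⟩
    by_contra! hlt
    rw [sigmaP_update a1 a2 hwf.finite_support, if_neg hlt.ne', if_neg hlt.not_gt] at hs
    have := sigmaP_le_epsP a1 a2 hwf hk
    rw [hki', heps] at this
    omega

lemma string_ineq_step (a1 a2 : ℤ) {y : ℤ → ℤ} (hy : FinP y) (κ : ℤ)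
    (h0 : epsP a1 a2 y (idx (κ + 1)) = 0) (c : ℕ) {A B C : ℤ} (hA : 0 ≤ A) (hB : 0 ≤ B)
    (hC0 : 0 ≤ C) (hC : C = aIdx a1 a2 κ * B - A) :
    (∀ l k, 1 ≤ l → l < k → idx l = idx κ → idx k = idx (κ + 1) →
      A * sigmaP a1 a2 (fPiter a1 a2 (idx (κ + 1)) c y) k +
        B * sigmaP a1 a2 (fPiter a1 a2 (idx (κ + 1)) c y) l ≤ 0) ↔
    (B * epsP a1 a2 y (idx κ) ≤ C * c ∧
      ∀ j l, 1 ≤ j → j < l → idx j = idx (κ + 1) → idx l = idx (κ + 1 + 1) →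
        B * sigmaP a1 a2 y l + C * sigmaP a1 a2 y j ≤ 0) := by
  obtain ⟨D, hD⟩ := exists_stringProfile a1 a2 hy (isI_idx (κ + 1)) h0 c
  have hne : idx κ ≠ idx (κ + 1) := by rw [Ne, idx_eq_iff]; omega
  have h2 : idx (κ + 1 + 1) = idx κ := by rw [idx_eq_iff]; omega
  have hoth : ∀ l, 1 ≤ l → idx l = idx κ → sigmaP a1 a2 (fPiter a1 a2 (idx (κ + 1)) c y) l =
      sigmaP a1 a2 y l - aIdx a1 a2 κ * D l := by
    intro l hl hli
    rw [hD.other l hl (hli ▸ hne)]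
    unfold aIdx; rw [(idx_eq_iff l κ).1 hli]
  have hL : (∀ l k, 1 ≤ l → l < k → idx l = idx κ → idx k = idx (κ + 1) →
      A * sigmaP a1 a2 (fPiter a1 a2 (idx (κ + 1)) c y) k +
        B * sigmaP a1 a2 (fPiter a1 a2 (idx (κ + 1)) c y) l ≤ 0) ↔
      ∀ l, 1 ≤ l → idx l = idx κ → B * sigmaP a1 a2 y l ≤ C * D l := by
    constructor
    · intro h l hl hli
      obtain ⟨k, hk, hki, hs⟩ := hD.sigma_eq l (by omega)
      have := h l k hl hk hli hki
      rw [hs, hoth l hl hli] at this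
      rw [hC]; linarith
    · intro h l k hl hlk hli hki
      have h1 := h l hl hli
      have h3 := mul_le_mul_of_nonneg_left (hD.sigma_le l k hlk (by omega) hki) hA
      rw [hoth l hl hli]
      rw [hC] at h1; linarith
  rw [hL, h2]
  constructor
  · intro h
    constructor
    · obtain ⟨l, hl, hli, hs⟩ := (epsP_isGreatest a1 a2 hy (isI_idx κ)).1
      rw [← hs]
      exact (h l hl hli).trans (mul_le_mul_of_nonneg_left (hD.le l) hC0)
    · intro j l hj hjl hji hli
      have h1 := h l (by omega) hli
      have h3 := mul_le_mul_of_nonneg_left (hD.le_neg l j hj hjl.le hji) hC0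
      linarith
  · rintro ⟨h, h'⟩ l hl hli
    rcases hD.eq_or l with h1 | ⟨j, hj, hjl, hji, h1⟩
    · rw [h1]
      have h3 := sigmaP_le_epsP a1 a2 hy hl
      rw [hli] at h3
      exact (mul_le_mul_of_nonneg_left h3 hB).trans h
    · have hjl' : j < l := lt_of_le_of_ne hjl fun h => hne (by rw [← hli, ← hji, h])
      have := h' j l hj hjl' hji hli
      rw [h1]; linarith

end HypCrystal

namespace HypCrystal

/-! ### The sequences `c_j` and the constants `γ_k` -/

/-- The sequence `c_j` attached to an arbitrary starting position `k`. -/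
def cc (a1 a2 k : ℤ) : ℕ → ℤ
  | 0 => 0
  | 1 => 1
  | n + 2 => aIdx a1 a2 (k + n) * cc a1 a2 k (n + 1) - cc a1 a2 k n

lemma cseq_eq_cc (a1 a2 : ℤ) : ∀ n, cseq a1 a2 n = cc a1 a2 1 n
  | 0 => rfl
  | 1 => rfl
  | n + 2 => by
    rw [cseq, cc, cseq_eq_cc a1 a2 (n + 1), cseq_eq_cc a1 a2 n]
    unfold aIdx
    congr 2
    split_ifs <;> first | rfl | omega

lemma cseq'_eq_cseq (a1 a2 : ℤ) : ∀ n, cseq' a1 a2 n = cseq a2 a1 n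
  | 0 => rfl
  | 1 => rfl
  | n + 2 => by rw [cseq, cseq', cseq'_eq_cseq a1 a2 (n + 1), cseq'_eq_cseq a1 a2 n]

lemma cc_casoratian (a1 a2 k : ℤ) (n : ℕ) :
    cc a1 a2 (k + 1) (n + 1) * cc a1 a2 k (n + 1) - cc a1 a2 (k + 1) n * cc a1 a2 k (n + 2) = 1 := by
  induction n with
  | zero => simp [cc]
  | succ n ih =>
    have e1 : cc a1 a2 (k + 1) (n + 2) =
      aIdx a1 a2 (k + 1 + n) * cc a1 a2 (k + 1) (n + 1) - cc a1 a2 (k + 1) n := rfl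
    have e2 : cc a1 a2 k (n + 3) =
      aIdx a1 a2 (k + (n + 1 : ℕ)) * cc a1 a2 k (n + 2) - cc a1 a2 k (n + 1) := rfl
    rw [show k + ((n + 1 : ℕ) : ℤ) = k + 1 + n by push_cast; ring] at e2
    rw [e1, e2]
    linear_combination ih

section Gamma

variable {a1 a2 : ℤ}

lemma gammaR_swap (k : ℤ) : gammaR a2 a1 (1 - k) = gammaR a1 a2 k := by
  have h : alphaR a2 a1 = betaR a1 a2 := by
    unfold alphaR betaR; rw [mul_comm (a2 : ℝ) a1]; congr 3; ring_nf
  have h' : betaR a2 a1 = alphaR a1 a2 := by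
    unfold alphaR betaR; rw [mul_comm (a2 : ℝ) a1]; congr 3; ring_nf
  unfold gammaR
  split_ifs <;> omega

lemma gammaR_mul_succ (k : ℤ) :
    gammaR a1 a2 k * gammaR a1 a2 (k + 1) = alphaR a1 a2 * betaR a1 a2 := by
  unfold gammaR
  split_ifs <;> first | omega | ring

variable (ha1 : 1 ≤ a1) (ha2 : 1 ≤ a2) (ha : 4 < a1 * a2)
include ha1 ha2

lemma alphaR_pos : 0 < alphaR a1 a2 := by
  have h1 : (0 : ℝ) < a1 := by exact_mod_cast (by omega : 0 < a1)
  have h2 : (0 : ℝ) < a2 := by exact_mod_cast (by omega : 0 < a2)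
  unfold alphaR; positivity

lemma betaR_pos : 0 < betaR a1 a2 := by
  have h1 : (0 : ℝ) < a1 := by exact_mod_cast (by omega : 0 < a1)
  have h2 : (0 : ℝ) < a2 := by exact_mod_cast (by omega : 0 < a2)
  unfold betaR; positivity

lemma gammaR_pos (k : ℤ) : 0 < gammaR a1 a2 k := by
  unfold gammaR; split_ifs
  exacts [alphaR_pos ha1 ha2, betaR_pos ha1 ha2]

lemma alphaR_eq : alphaR a1 a2 * a2 = betaR a1 a2 * a1 := by
  have h1 : (0 : ℝ) < a1 := by exact_mod_cast (by omega : 0 < a1)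
  have h2 : (0 : ℝ) < a2 := by exact_mod_cast (by omega : 0 < a2)
  unfold alphaR betaR; field_simp

include ha

lemma alphaR_mul_betaR : alphaR a1 a2 * betaR a1 a2 = betaR a1 a2 * a1 - 1 := by
  have h1 : (0 : ℝ) < a1 := by exact_mod_cast (by omega : 0 < a1)
  have h2 : (0 : ℝ) < a2 := by exact_mod_cast (by omega : 0 < a2)
  have h4 : (4 : ℝ) < a1 * a2 := by exact_mod_cast ha
  have hs : Real.sqrt ((a1 : ℝ) ^ 2 * (a2 : ℝ) ^ 2 - 4 * a1 * a2) ^ 2 =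
      (a1 : ℝ) ^ 2 * (a2 : ℝ) ^ 2 - 4 * a1 * a2 := Real.sq_sqrt (by nlinarith)
  unfold alphaR betaR
  generalize Real.sqrt ((a1 : ℝ) ^ 2 * (a2 : ℝ) ^ 2 - 4 * a1 * a2) = s at *
  field_simp
  nlinarith

lemma one_lt_alphaR_mul_betaR : 1 < alphaR a1 a2 * betaR a1 a2 := by
  have h1 : (0 : ℝ) < a1 := by exact_mod_cast (by omega : 0 < a1)
  have h4 : (4 : ℝ) < a1 * a2 := by exact_mod_cast ha
  have h5 : 2 < betaR a1 a2 * a1 := by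
    unfold betaR
    rw [div_mul_eq_mul_div, lt_div_iff₀ (by positivity)]
    have := Real.sqrt_nonneg ((a1 : ℝ) ^ 2 * (a2 : ℝ) ^ 2 - 4 * a1 * a2)
    nlinarith
  rw [alphaR_mul_betaR ha1 ha2 ha]; linarith

lemma gammaR_succ_mul (k : ℤ) :
    gammaR a1 a2 (k + 1) * gammaR a1 a2 k = aIdx a1 a2 k * gammaR a1 a2 k - 1 := by
  have h1 := alphaR_mul_betaR ha1 ha2 ha
  have h2 := alphaR_eq ha1 ha2
  unfold gammaR aIdx
  split_ifs <;> first | omega | linarith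

lemma cc_sub_gammaR_succ (k : ℤ) (n : ℕ) :
    ((cc a1 a2 k (n + 2) : ℝ) - gammaR a1 a2 (k + n + 1) * cc a1 a2 k (n + 1)) *
      gammaR a1 a2 (k + n) = cc a1 a2 k (n + 1) - gammaR a1 a2 (k + n) * cc a1 a2 k n := by
  have h := gammaR_succ_mul ha1 ha2 ha (k + n)
  rw [cc]; push_cast
  linear_combination (-(cc a1 a2 k (n + 1) : ℝ)) * h

lemma cc_sub_gammaR_pos (k : ℤ) (n : ℕ) :
    0 < (cc a1 a2 k (n + 1) : ℝ) - gammaR a1 a2 (k + n) * cc a1 a2 k n := by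
  induction n with
  | zero => simp [cc]
  | succ n ih =>
    have h := cc_sub_gammaR_succ ha1 ha2 ha k n
    rw [← h] at ih
    have := pos_of_mul_pos_left ih (gammaR_pos ha1 ha2 _).le
    rw [show k + ((n + 1 : ℕ) : ℤ) = k + n + 1 by push_cast; ring]
    exact this

lemma cc_sub_gammaR_two_mul (k : ℤ) (t : ℕ) :
    ((cc a1 a2 k (2 * t + 1) : ℝ) - gammaR a1 a2 (k + (2 * t : ℕ)) * cc a1 a2 k (2 * t)) *
      (alphaR a1 a2 * betaR a1 a2) ^ t = 1 := by
  induction t with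
  | zero => simp [cc]
  | succ t ih =>
    have h1 := cc_sub_gammaR_succ ha1 ha2 ha k (2 * t)
    have h2 := cc_sub_gammaR_succ ha1 ha2 ha k (2 * t + 1)
    have h3 := gammaR_mul_succ (a1 := a1) (a2 := a2) (k + (2 * t : ℕ))
    rw [show k + ((2 * t + 1 : ℕ) : ℤ) = k + (2 * t : ℕ) + 1 by push_cast; ring] at h2
    rw [show k + ((2 * (t + 1) : ℕ) : ℤ) = k + (2 * t : ℕ) + 1 + 1 by push_cast; ring,
      show 2 * (t + 1) + 1 = 2 * t + 1 + 2 by ring, show 2 * (t + 1) = 2 * t + 1 + 1 by ring]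
    rw [pow_succ]
    rw [← h1, ← h2] at ih
    rw [← ih]
    linear_combination (-((cc a1 a2 k (2 * t + 1 + 2) : ℝ) -
      gammaR a1 a2 (k + (2 * t : ℕ) + 1 + 1) * cc a1 a2 k (2 * t + 1 + 1)) *
      (alphaR a1 a2 * betaR a1 a2) ^ t) * h3

lemma cc_pos (k : ℤ) (n : ℕ) : 0 < cc a1 a2 k (n + 1) := by
  induction n with
  | zero => simp [cc]
  | succ n ih =>
    have h := cc_sub_gammaR_pos ha1 ha2 ha k (n + 1)
    have h2 : (0 : ℝ) < cc a1 a2 k (n + 1) := by exact_mod_cast ih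
    have h3 := mul_pos (gammaR_pos ha1 ha2 (k + (n + 1 : ℕ))) h2
    have : (0 : ℝ) < cc a1 a2 k (n + 1 + 1) := by linarith
    exact_mod_cast this

lemma cc_nonneg (k : ℤ) : ∀ n : ℕ, 0 ≤ cc a1 a2 k n
  | 0 => le_rfl
  | n + 1 => (cc_pos ha1 ha2 ha k n).le

lemma cc_ineq_of_gammaR_ineq {k : ℤ} (n : ℕ) {s t : ℤ} (hs : 0 ≤ s)
    (h : (t : ℝ) ≤ gammaR a1 a2 (k + n) * s) : cc a1 a2 k n * t ≤ cc a1 a2 k (n + 1) * s := by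
  have h1 := cc_sub_gammaR_pos ha1 ha2 ha k n
  have h2 : (0 : ℝ) ≤ s := by exact_mod_cast hs
  have h3 : (0 : ℝ) ≤ cc a1 a2 k n := by exact_mod_cast cc_nonneg ha1 ha2 ha k n
  have h4 := mul_le_mul_of_nonneg_left h h3
  have h5 := mul_nonneg h1.le h2
  have : (cc a1 a2 k n : ℝ) * t ≤ cc a1 a2 k (n + 1) * s := by linarith
  exact_mod_cast this

lemma gammaR_ineq_of_cc_ineq (m : ℤ) {s t : ℤ} (hs : 0 ≤ s)
    (h : ∀ n : ℕ, cc a1 a2 (m - (n + 1 : ℕ)) (n + 1) * t ≤ cc a1 a2 (m - (n + 1 : ℕ)) (n + 2) * s) :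
    (t : ℝ) ≤ gammaR a1 a2 m * s := by
  set r := alphaR a1 a2 * betaR a1 a2 with hr
  have hr1 : 1 < r := one_lt_alphaR_mul_betaR ha1 ha2 ha
  have hs' : (0 : ℝ) ≤ s := by exact_mod_cast hs
  have key : ∀ n : ℕ, (t : ℝ) - gammaR a1 a2 m * s ≤ s * r⁻¹ ^ (n + 1) := by
    intro n
    have h1 := h (2 * n + 1)
    rw [show 2 * n + 1 + 1 = 2 * (n + 1) by ring, show 2 * n + 1 + 2 = 2 * (n + 1) + 1 by ring] at h1
    have h2 := cc_sub_gammaR_two_mul ha1 ha2 ha (m - (2 * (n + 1) : ℕ)) (n + 1)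
    rw [sub_add_cancel] at h2
    have h3 : (1 : ℝ) ≤ cc a1 a2 (m - (2 * (n + 1) : ℕ)) (2 * (n + 1)) := by
      exact_mod_cast cc_pos ha1 ha2 ha (m - (2 * (n + 1) : ℕ)) (2 * n + 1)
    have h1' : (cc a1 a2 (m - (2 * (n + 1) : ℕ)) (2 * (n + 1)) : ℝ) * t ≤
        cc a1 a2 (m - (2 * (n + 1) : ℕ)) (2 * (n + 1) + 1) * s := by exact_mod_cast h1
    generalize (cc a1 a2 (m - (2 * (n + 1) : ℕ)) (2 * (n + 1)) : ℝ) = C at *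
    generalize (cc a1 a2 (m - (2 * (n + 1) : ℕ)) (2 * (n + 1) + 1) : ℝ) = C' at *
    have h5 : C' - gammaR a1 a2 m * C = r⁻¹ ^ (n + 1) := by
      rw [inv_pow]; exact eq_inv_of_mul_eq_one_left h2
    have h6 : 0 ≤ (s : ℝ) * r⁻¹ ^ (n + 1) := by positivity
    rw [← h5] at h6 ⊢
    by_contra! hlt
    nlinarith
  have hlim : Tendsto (fun n : ℕ => (s : ℝ) * r⁻¹ ^ (n + 1)) atTop (nhds (s * 0)) :=
    ((tendsto_pow_atTop_nhds_zero_of_lt_one (by positivity)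
      (inv_lt_one_of_one_lt₀ hr1)).comp (tendsto_add_atTop_nat 1)).const_mul _
  have := ge_of_tendsto' hlim key
  linarith

lemma cc_ineq_succ {k : ℤ} (n : ℕ) {s t : ℤ} (hs : 0 ≤ s)
    (h : cc a1 a2 k (n + 1) * t ≤ cc a1 a2 k (n + 2) * s) :
    cc a1 a2 (k + 1) n * t ≤ cc a1 a2 (k + 1) (n + 1) * s := by
  have h1 := cc_casoratian a1 a2 k n
  have h2 := cc_nonneg ha1 ha2 ha (k + 1) n
  have h3 := cc_pos ha1 ha2 ha k n
  refine le_of_mul_le_mul_left ?_ h3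
  have h4 := mul_le_mul_of_nonneg_left h h2
  nlinarith

end Gamma

/-! ### String chains in `ℤ^{+∞}` -/

/-- `Y k = f̃_{i_{k+1}}^{u_{k+1}} f̃_{i_{k+2}}^{u_{k+2}} ⋯ (z_∞)`. -/
structure IsChainP (a1 a2 : ℤ) (u : ℤ → ℤ) (Y : ℤ → ℤ → ℤ) : Prop where
  step : ∀ k, Y k = fPiter a1 a2 (idx (k + 1)) (u (k + 1)).toNat (Y (k + 1))
  fin : ∀ k, FinP (Y k)
  zero : ∃ N, ∀ k, N ≤ k → Y k = fun _ => 0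

lemma exists_isChainP (a1 a2 : ℤ) {u : ℤ → ℤ} {N : ℤ} (hN : ∀ k, N < k → u k = 0) :
    ∃ Y, IsChainP a1 a2 u Y ∧ ∀ k, N ≤ k → Y k = fun _ => 0 := by
  let y : ℕ → ℤ → ℤ := Nat.rec (fun _ => 0)
    (fun n w => fPiter a1 a2 (idx (N - n)) (u (N - n)).toNat w)
  have hz : ∀ k, N ≤ k → y (N - k).toNat = fun _ => 0 := fun k hk => by
    rw [show (N - k).toNat = 0 by omega]; rfl
  refine ⟨fun k => y (N - k).toNat, ⟨fun k => ?_, fun k => ?_, N, hz⟩, hz⟩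
  · rcases le_or_gt N k with h | h
    · rw [hz k h, hz (k + 1) (by omega), hN (k + 1) (by omega)]; rfl
    · obtain ⟨n, hn⟩ := Int.eq_ofNat_of_zero_le (show 0 ≤ N - (k + 1) by omega)
      rw [show (N - k).toNat = n + 1 by omega, show (N - (k + 1)).toNat = n by omega,
        show k + 1 = N - n by omega]
  · show FinP (y (N - k).toNat)
    generalize (N - k).toNat = n
    induction n with
    | zero => exact finP_zero
    | succ n ih => exact ih.fPiter a1 a2 (isI_idx _) _

section Chain

variable {a1 a2 : ℤ} (ha1 : 1 ≤ a1) (ha2 : 1 ≤ a2) (ha : 4 < a1 * a2)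
  {u : ℤ → ℤ} {Y : ℤ → ℤ → ℤ} (hY : IsChainP a1 a2 u Y)
include hY

lemma IsChainP.epsP_eq {k : ℤ} (hu : 0 ≤ u (k + 1))
    (h : epsP a1 a2 (Y (k + 1)) (idx (k + 1)) = 0) : epsP a1 a2 (Y k) (idx (k + 1)) = u (k + 1) := by
  rw [hY.step k, epsP_fPiter a1 a2 (hY.fin _) (isI_idx _) h]
  exact Int.toNat_of_nonneg hu

include ha1 ha2 ha

lemma IsChainP.string_ineq_iff {k : ℤ} (hu : ∀ j, k < j → 0 ≤ u j)
    (hs : ∀ j, k < j → epsP a1 a2 (Y j) (idx j) = 0) (m : ℕ) :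
    epsP a1 a2 (Y k) (idx k) = 0 ↔
      (∀ n : ℕ, n < m → cc a1 a2 k (n + 1) * u (k + n + 2) ≤ cc a1 a2 k (n + 2) * u (k + n + 1)) ∧
      ∀ l j, 1 ≤ l → l < j → idx l = idx (k + m) → idx j = idx (k + m + 1) →
        cc a1 a2 k m * sigmaP a1 a2 (Y (k + m)) j +
          cc a1 a2 k (m + 1) * sigmaP a1 a2 (Y (k + m)) l ≤ 0 := by
  induction m with
  | zero =>
    simp only [cc, Nat.cast_zero, add_zero, zero_mul, one_mul, zero_add]
    constructor
    · intro h
      refine ⟨by simp, fun l j hl _ hli _ => ?_⟩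
      rw [← h, ← hli]; exact sigmaP_le_epsP a1 a2 (hY.fin k) hl
    · rintro ⟨-, h⟩
      refine le_antisymm ?_ (epsP_nonneg a1 a2 (hY.fin k) (isI_idx k))
      obtain ⟨l, hl, hli, hs⟩ := (epsP_isGreatest a1 a2 (hY.fin k) (isI_idx k)).1
      obtain ⟨j, hj, hji⟩ := exists_idx_eq (isI_idx (k + 1)) l
      rw [← hs]; exact h l j hl hj hli hji
  | succ m ih =>
    rw [ih]
    have hu1 := hu (k + m + 1) (by omega)
    have hstep := string_ineq_step a1 a2 (hY.fin (k + m + 1)) (k + m) (hs (k + m + 1) (by omega))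
      (u (k + m + 1)).toNat (cc_nonneg ha1 ha2 ha k m) (cc_nonneg ha1 ha2 ha k (m + 1))
      (cc_nonneg ha1 ha2 ha k (m + 2)) rfl
    rw [← hY.step (k + m)] at hstep
    have heps : epsP a1 a2 (Y (k + m + 1)) (idx (k + m)) = u (k + m + 2) := by
      have := hY.epsP_eq (k := k + m + 1) (hu _ (by omega)) (hs _ (by omega))
      rw [show idx (k + m) = idx (k + m + 1 + 1) by rw [idx_eq_iff]; omega, this]
      congr 1; ring
    rw [hstep, heps, Int.toNat_of_nonneg hu1, ← and_assoc]
    rw [show k + ((m + 1 : ℕ) : ℤ) = k + m + 1 by push_cast; ring]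
    refine and_congr ⟨fun h n hn => ?_, fun h => ⟨fun n hn => h n (by omega), h m (by omega)⟩⟩ Iff.rfl
    rcases Nat.lt_succ_iff_lt_or_eq.1 hn with hn | rfl
    exacts [h.1 n hn, h.2]

lemma IsChainP.string_iff {k : ℤ} (hu : ∀ j, k < j → 0 ≤ u j)
    (hs : ∀ j, k < j → epsP a1 a2 (Y j) (idx j) = 0) :
    epsP a1 a2 (Y k) (idx k) = 0 ↔
      ∀ n : ℕ, cc a1 a2 k (n + 1) * u (k + n + 2) ≤ cc a1 a2 k (n + 2) * u (k + n + 1) := by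
  constructor
  · intro h n
    exact ((hY.string_ineq_iff ha1 ha2 ha hu hs (n + 1)).1 h).1 n (by omega)
  · intro h
    obtain ⟨N, hN⟩ := hY.zero
    refine (hY.string_ineq_iff ha1 ha2 ha hu hs (N - k).toNat).2 ⟨fun n _ => h n, ?_⟩
    intro l j _ _ _ _
    rw [hN _ (by omega), sigmaP_zero, sigmaP_zero]; simp

lemma IsChainP.string_of_ineq {m : ℤ} (hu : ∀ j, m < j → 0 ≤ u j)
    (h : ∀ k, m ≤ k → ∀ n : ℕ,
      cc a1 a2 k (n + 1) * u (k + n + 2) ≤ cc a1 a2 k (n + 2) * u (k + n + 1)) :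
    ∀ k, m ≤ k → epsP a1 a2 (Y k) (idx k) = 0 := by
  obtain ⟨N, hN⟩ := hY.zero
  have key : ∀ t : ℕ, ∀ k, m ≤ k → N - t ≤ k → epsP a1 a2 (Y k) (idx k) = 0 := by
    intro t
    induction t with
    | zero => intro k _ hk; rw [hN k (by simpa using hk)]; exact epsP_zero a1 a2 (isI_idx k)
    | succ t ih =>
      intro k hk hkt
      push_cast at hkt
      exact (hY.string_iff ha1 ha2 ha (fun j hj => hu j (by omega))
        (fun j hj => ih j (by omega) (by omega))).2 (h k hk)
  intro k hk
  exact key (N - k).toNat k hk (by omega)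

lemma IsChainP.string_iff_gammaR (hu : ∀ j, 0 ≤ u j) :
    (∀ k, epsP a1 a2 (Y k) (idx k) = 0) ↔ ∀ k, (u (k + 1) : ℝ) ≤ gammaR a1 a2 k * u k := by
  constructor
  · intro h k
    refine gammaR_ineq_of_cc_ineq ha1 ha2 ha k (hu k) fun n => ?_
    have := (hY.string_iff ha1 ha2 ha (k := k - (n + 1 : ℕ)) (fun j _ => hu j) (fun j _ => h j)).1
      (h _) n
    convert this using 3 <;> push_cast <;> ring
  · intro h k
    refine hY.string_of_ineq ha1 ha2 ha (m := k) (fun j _ => hu j) (fun k _ n => ?_) k le_rfl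
    refine cc_ineq_of_gammaR_ineq ha1 ha2 ha (n + 1) (hu _) ?_
    convert h (k + n + 1) using 3 <;> push_cast <;> ring

/-- The inequalities defining `X+` make the chain a string at all positions `≥ 1`. -/
lemma IsChainP.string_of_cseq (hu : ∀ j, 1 ≤ j → 0 ≤ u j)
    (h : ∀ j : ℤ, 1 ≤ j → 0 ≤ cseq a1 a2 j.toNat * u j - cseq a1 a2 (j - 1).toNat * u (j + 1)) :
    ∀ k, 1 ≤ k → epsP a1 a2 (Y k) (idx k) = 0 := by
  refine hY.string_of_ineq ha1 ha2 ha (fun j hj => hu j (by omega)) ?_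
  have key : ∀ t n : ℕ, cc a1 a2 (t + 1) (n + 1) * u (t + 1 + n + 2) ≤
      cc a1 a2 (t + 1) (n + 2) * u (t + 1 + n + 1) := by
    intro t
    induction t with
    | zero =>
      intro n
      have := h (n + 2) (by omega)
      rw [cseq_eq_cc, cseq_eq_cc, show ((n : ℤ) + 2).toNat = n + 2 by omega,
        show ((n : ℤ) + 2 - 1).toNat = n + 1 by omega] at this
      rw [show ((0 : ℕ) : ℤ) + 1 = 1 by norm_num, show (1 : ℤ) + n + 2 = n + 2 + 1 by ring,
        show (1 : ℤ) + n + 1 = n + 2 by ring]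
      omega
    | succ t ih =>
      intro n
      have := ih (n + 1)
      push_cast at this ⊢
      have h2 := cc_ineq_succ ha1 ha2 ha (n + 1) (hu _ (by omega)) this
      convert h2 using 3 <;> ring
  intro k hk n
  have := key (k - 1).toNat n
  rwa [show ((k - 1).toNat : ℤ) + 1 = k by omega] at this

end Chain

end HypCrystal

namespace HypCrystal

/-! ### The crystal `ℤ^{−∞}` as a mirror image of `ℤ^{+∞}` -/

/-- The reflection exchanging `ℤ^{−∞}` for `(a1, a2)` with `ℤ^{+∞}` for `(a2, a1)`. -/
def mir (z : ℤ → ℤ) : ℤ → ℤ := fun k => -z (1 - k)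

lemma mir_mir (z : ℤ → ℤ) : mir (mir z) = z := by
  funext k; simp [mir]

lemma FinM.mir {z : ℤ → ℤ} (hz : FinM z) : FinP (mir z) := by
  obtain ⟨h0, N, hN⟩ := hz
  refine ⟨fun k hk => ?_, 1 - N, fun k hk => ?_⟩
  · unfold HypCrystal.mir; rw [h0 _ (by omega), neg_zero]
  · unfold HypCrystal.mir; rw [hN _ (by omega), neg_zero]

lemma FinP.mir {y : ℤ → ℤ} (hy : FinP y) : FinM (mir y) := by
  obtain ⟨h0, N, hN⟩ := hy
  refine ⟨fun k hk => ?_, 1 - N, fun k hk => ?_⟩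
  · unfold HypCrystal.mir; rw [h0 _ (by omega), neg_zero]
  · unfold HypCrystal.mir; rw [hN _ (by omega), neg_zero]

lemma idx_one_sub (k : ℤ) : idx (1 - k) = 3 - idx k := by
  unfold idx; split_ifs <;> omega

lemma IsI.three_sub {i : ℤ} (hi : IsI i) : IsI (3 - i) := by
  unfold IsI at *; omega

lemma sigmaM_eq (a1 a2 : ℤ) (z : ℤ → ℤ) (k : ℤ) :
    sigmaM a1 a2 z k = sigmaP a2 a1 (mir z) (1 - k) := by
  have h : ∑ᶠ j : ℤ, (if 1 - k < j then pairJK a2 a1 j (1 - k) * mir z j else 0) =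
      ∑ᶠ j : ℤ, -(if j < k then pairJK a1 a2 j k * z j else 0) := by
    rw [← finsum_comp_equiv (Equiv.subLeft (1 : ℤ))]
    refine finsum_congr fun j => ?_
    have hp : pairJK a2 a1 (1 - j) (1 - k) = pairJK a1 a2 j k := by
      unfold pairJK; split_ifs <;> omega
    rw [Equiv.subLeft_apply, hp, mir, sub_sub_cancel]
    split_ifs <;> first | omega | ring
  unfold sigmaM sigmaP
  rw [h, finsum_neg_distrib, mir, sub_sub_cancel, sub_eq_add_neg]

lemma phiMf_eq (a1 a2 : ℤ) (z : ℤ → ℤ) (i : ℤ) :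
    phiMf a1 a2 z i = epsP a2 a1 (mir z) (3 - i) := by
  unfold phiMf epsP
  congr 1
  ext s
  constructor
  · rintro ⟨k, hk, rfl, rfl⟩
    exact ⟨1 - k, by omega, idx_one_sub k, (sigmaM_eq a1 a2 z k).symm⟩
  · rintro ⟨k, hk, hi, rfl⟩
    refine ⟨1 - k, by omega, by rw [idx_one_sub, hi]; ring, ?_⟩
    rw [sigmaM_eq, sub_sub_cancel]

lemma phiMf_isGreatest (a1 a2 : ℤ) {z : ℤ → ℤ} (hz : FinM z) {i : ℤ} (hi : IsI i) :
    IsGreatest {s : ℤ | ∃ k : ℤ, k ≤ 0 ∧ idx k = i ∧ sigmaM a1 a2 z k = s} (phiMf a1 a2 z i) := by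
  rw [phiMf_eq]
  have h := epsP_isGreatest a2 a1 hz.mir hi.three_sub
  constructor
  · obtain ⟨k, hk, hki, hs⟩ := h.1
    refine ⟨1 - k, by omega, by rw [idx_one_sub, hki]; ring, ?_⟩
    rw [sigmaM_eq, sub_sub_cancel, hs]
  · rintro s ⟨k, hk, rfl, rfl⟩
    exact h.2 ⟨1 - k, by omega, idx_one_sub k, (sigmaM_eq a1 a2 z k).symm⟩

lemma phiMf_nonneg (a1 a2 : ℤ) {z : ℤ → ℤ} (hz : FinM z) {i : ℤ} (hi : IsI i) :
    0 ≤ phiMf a1 a2 z i := by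
  rw [phiMf_eq]; exact epsP_nonneg a2 a1 hz.mir hi.three_sub

lemma kmaxM_isGreatest (a1 a2 : ℤ) {z : ℤ → ℤ} (hz : FinM z) {i : ℤ} (hi : IsI i) :
    IsGreatest {k : ℤ | k ≤ 0 ∧ idx k = i ∧ sigmaM a1 a2 z k = phiMf a1 a2 z i}
      (1 - kminP a2 a1 (mir z) (3 - i)) := by
  obtain ⟨⟨h1, h2, h3⟩, h4⟩ := kminP_isLeast a2 a1 hz.mir hi.three_sub
  refine ⟨⟨by omega, by rw [idx_one_sub, h2]; ring, ?_⟩, ?_⟩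
  · rw [sigmaM_eq, phiMf_eq, sub_sub_cancel, h3]
  · rintro k ⟨hk, rfl, hs⟩
    have := h4 (a := 1 - k) ⟨by omega, idx_one_sub k, by rw [← sigmaM_eq, ← phiMf_eq, hs]⟩
    omega

lemma kmaxM_eq (a1 a2 : ℤ) {z : ℤ → ℤ} (hz : FinM z) {i : ℤ} (hi : IsI i) :
    kmaxM a1 a2 z i = 1 - kminP a2 a1 (mir z) (3 - i) :=
  (kmaxM_isGreatest a1 a2 hz hi).csSup_eq

lemma mir_eM (a1 a2 : ℤ) {z : ℤ → ℤ} (hz : FinM z) {i : ℤ} (hi : IsI i) :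
    mir (eM a1 a2 i z) = fP a2 a1 (3 - i) (mir z) := by
  have h := kmaxM_eq a1 a2 hz hi
  unfold eM fP
  rw [h]
  generalize kminP a2 a1 (mir z) (3 - i) = m
  funext k
  by_cases hk : k = m
  · subst hk; simp [mir]; ring
  · rw [update_of_ne hk, mir, mir, update_of_ne (by omega)]

lemma FinM.eM (a1 a2 : ℤ) {z : ℤ → ℤ} (hz : FinM z) {i : ℤ} (hi : IsI i) :
    FinM (eM a1 a2 i z) := by
  rw [← mir_mir (HypCrystal.eM a1 a2 i z), mir_eM a1 a2 hz hi]
  exact (hz.mir.fP a2 a1 hi.three_sub).mir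

lemma eMiter_succ (a1 a2 i : ℤ) (n : ℕ) (z : ℤ → ℤ) :
    eMiter a1 a2 i (n + 1) z = eM a1 a2 i (eMiter a1 a2 i n z) :=
  iterate_succ_apply' _ _ _

lemma FinM.eMiter (a1 a2 : ℤ) {z : ℤ → ℤ} (hz : FinM z) {i : ℤ} (hi : IsI i) (n : ℕ) :
    FinM (eMiter a1 a2 i n z) := by
  induction n with
  | zero => exact hz
  | succ n ih => rw [eMiter_succ]; exact ih.eM a1 a2 hi

lemma mir_eMiter (a1 a2 : ℤ) {z : ℤ → ℤ} (hz : FinM z) {i : ℤ} (hi : IsI i) (n : ℕ) :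
    mir (eMiter a1 a2 i n z) = fPiter a2 a1 (3 - i) n (mir z) := by
  induction n with
  | zero => rfl
  | succ n ih => rw [eMiter_succ, mir_eM a1 a2 (hz.eMiter a1 a2 hi n) hi, ih, fPiter_succ]

lemma wtOf_eMiter (a1 a2 : ℤ) {z : ℤ → ℤ} (hz : FinM z) (κ : ℤ) (n : ℕ) :
    wtOf a1 a2 (eMiter a1 a2 (idx κ) n z) = wtOf a1 a2 z + (n : ℤ) • alphaOf a1 a2 κ := by
  induction n with
  | zero => simp [eMiter]
  | succ n ih =>
    have hf := hz.eMiter a1 a2 (isI_idx κ) n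
    have hk := (kmaxM_isGreatest a1 a2 hf (isI_idx κ)).1.2.1
    rw [← kmaxM_eq a1 a2 hf (isI_idx κ)] at hk
    rw [eMiter_succ, eM, sub_eq_add_neg, wtOf_update a1 a2 hf.finite_support, ih,
      alphaOf_congr a1 a2 hk]
    push_cast
    rw [add_smul, neg_smul]; abel

lemma phiMf_eMiter (a1 a2 : ℤ) {z : ℤ → ℤ} (hz : FinM z) {i : ℤ} (hi : IsI i)
    (h0 : phiMf a1 a2 z i = 0) (c : ℕ) : phiMf a1 a2 (eMiter a1 a2 i c z) i = c := by
  rw [phiMf_eq] at h0 ⊢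
  rw [mir_eMiter a1 a2 hz hi, epsP_fPiter a2 a1 hz.mir hi.three_sub h0]

lemma kmaxM_eMiter_isLeast (a1 a2 : ℤ) {z : ℤ → ℤ} (hz : FinM z) {i : ℤ} (hi : IsI i)
    (h0 : phiMf a1 a2 z i = 0) (c : ℕ) :
    IsLeast {k : ℤ | k ≤ 0 ∧ idx k = i ∧ sigmaM a1 a2 (eMiter a1 a2 i (c + 1) z) k = c + 1}
      (kmaxM a1 a2 (eMiter a1 a2 i c z) i) := by
  rw [phiMf_eq] at h0
  obtain ⟨⟨h1, h2, h3⟩, h4⟩ := kminP_fPiter_isGreatest a2 a1 hz.mir hi.three_sub h0 c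
  rw [kmaxM_eq a1 a2 (hz.eMiter a1 a2 hi c) hi, mir_eMiter a1 a2 hz hi]
  refine ⟨⟨by omega, by rw [idx_one_sub, h2]; ring, ?_⟩, ?_⟩
  · rw [sigmaM_eq, mir_eMiter a1 a2 hz hi, sub_sub_cancel, h3]
  · rintro k ⟨hk, rfl, hs⟩
    rw [sigmaM_eq, mir_eMiter a1 a2 hz (isI_idx k)] at hs
    have := h4 (a := 1 - k) ⟨by omega, idx_one_sub k, hs⟩
    omega

/-! ### String chains in `ℤ^{−∞}` -/

/-- `Z k = ẽ_{i_k}^{v_k} ẽ_{i_{k-1}}^{v_{k-1}} ⋯ (z_{−∞})`. -/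
structure IsChainM (a1 a2 : ℤ) (v : ℤ → ℤ) (Z : ℤ → ℤ → ℤ) : Prop where
  step : ∀ k, Z (k + 1) = eMiter a1 a2 (idx (k + 1)) (v (k + 1)).toNat (Z k)
  fin : ∀ k, FinM (Z k)
  zero : ∃ N, ∀ k, k ≤ N → Z k = fun _ => 0

lemma mir_zero : mir (fun _ => 0) = fun _ => 0 := by funext k; simp [mir]

lemma exists_isChainM (a1 a2 : ℤ) {v : ℤ → ℤ} {N : ℤ} (hN : ∀ k, k ≤ N → v k = 0) :
    ∃ Z, IsChainM a1 a2 v Z ∧ ∀ k, k ≤ N → Z k = fun _ => 0 := by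
  obtain ⟨Y, hY, hY0⟩ := exists_isChainP a2 a1 (u := fun k => v (1 - k)) (N := -N)
    (fun k hk => hN _ (by omega))
  have hz : ∀ k, k ≤ N → mir (Y (-k)) = fun _ => 0 := fun k hk => by
    rw [hY0 _ (by omega), mir_zero]
  refine ⟨fun k => mir (Y (-k)), ⟨fun k => ?_, fun k => (hY.fin _).mir, N, hz⟩, hz⟩
  have h := hY.step (-(k + 1))
  rw [show -(k + 1) + 1 = -k by ring] at h
  have h2 := mir_eMiter a1 a2 (hY.fin (-k)).mir (isI_idx (k + 1)) (v (k + 1)).toNat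
  rw [mir_mir, ← idx_one_sub, show 1 - (k + 1) = -k by ring] at h2
  rw [sub_neg_eq_add, add_comm 1 k, ← h2] at h
  show mir (Y (-(k + 1))) = _
  rw [h, mir_mir]

section ChainM

variable {a1 a2 : ℤ} (ha1 : 1 ≤ a1) (ha2 : 1 ≤ a2) (ha : 4 < a1 * a2)
  {v : ℤ → ℤ} {Z : ℤ → ℤ → ℤ} (hZ : IsChainM a1 a2 v Z)
include hZ

lemma IsChainM.isChainP : IsChainP a2 a1 (fun k => v (1 - k)) (fun k => mir (Z (-k))) := by
  obtain ⟨N, hN⟩ := hZ.zero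
  refine ⟨fun k => ?_, fun k => (hZ.fin _).mir, -N, fun k hk => ?_⟩
  · have h := hZ.step (-(k + 1))
    rw [show -(k + 1) + 1 = -k by ring] at h
    show mir (Z (-k)) = _
    rw [h, mir_eMiter a1 a2 (hZ.fin _) (isI_idx _), ← idx_one_sub]
    rw [show 1 - -k = k + 1 by ring, show 1 - (k + 1) = -k by ring]
  · show mir (Z (-k)) = _
    rw [hN _ (by omega), mir_zero]

lemma IsChainM.phiMf_eq {k : ℤ} (hv : 0 ≤ v (k + 1))
    (h : phiMf a1 a2 (Z k) (idx (k + 1)) = 0) :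
    phiMf a1 a2 (Z (k + 1)) (idx (k + 1)) = v (k + 1) := by
  rw [hZ.step k, phiMf_eMiter a1 a2 (hZ.fin _) (isI_idx _) h]
  exact Int.toNat_of_nonneg hv

omit hZ in
lemma phiMf_idx_eq (a1 a2 : ℤ) (Z : ℤ → ℤ → ℤ) (k : ℤ) :
    phiMf a1 a2 (Z k) (idx (k + 1)) = epsP a2 a1 (mir (Z (- -k))) (idx (-k)) := by
  rw [HypCrystal.phiMf_eq, ← idx_one_sub, neg_neg, show 1 - (k + 1) = -k by ring]

include ha1 ha2 ha

lemma IsChainM.string_iff_gammaR (hv : ∀ j, 0 ≤ v j) :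
    (∀ k, phiMf a1 a2 (Z k) (idx (k + 1)) = 0) ↔
      ∀ k, (v (k - 1) : ℝ) ≤ gammaR a1 a2 k * v k := by
  have h := hZ.isChainP.string_iff_gammaR ha2 ha1 (by rwa [mul_comm]) fun j => hv _
  constructor
  · intro h1 k
    have := h.1 (fun k => by simpa only [phiMf_idx_eq, neg_neg] using h1 (-k)) (1 - k)
    rwa [gammaR_swap, sub_sub_cancel, show 1 - (1 - k + 1) = k - 1 by ring] at this
  · intro h1 k
    rw [phiMf_idx_eq]
    refine h.2 (fun k => ?_) (-k)
    have := h1 (1 - k)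
    rwa [← gammaR_swap, sub_sub_cancel, show 1 - k - 1 = 1 - (k + 1) by ring] at this

/-- The inequalities defining `X−` make the chain a string at all positions `≤ 0`. -/
lemma IsChainM.string_of_cseq (hv : ∀ j, j ≤ 0 → 0 ≤ v j)
    (h : ∀ j : ℤ, j ≤ 0 →
      0 ≤ cseq' a1 a2 (1 - j).toNat * v j - cseq' a1 a2 (-j).toNat * v (j - 1)) :
    ∀ k, k ≤ -1 → phiMf a1 a2 (Z k) (idx (k + 1)) = 0 := by
  intro k hk
  rw [phiMf_idx_eq]
  refine hZ.isChainP.string_of_cseq ha2 ha1 (by rwa [mul_comm]) (fun j hj => hv _ (by omega))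
    (fun j hj => ?_) (-k) (by omega)
  have := h (1 - j) (by omega)
  rwa [cseq'_eq_cseq, cseq'_eq_cseq, sub_sub_cancel, show -(1 - j) = j - 1 by ring,
    show 1 - j - 1 = 1 - (j + 1) by ring] at this

end ChainM

end HypCrystal

namespace HypCrystal

/-! ### The crystal `Z_ι(μ)` -/

lemma update_combine_pos (y z : ℤ → ℤ) {k : ℤ} (hk : 1 ≤ k) (v : ℤ) :
    update (combine y z) k v = combine (update y k v) z := by
  funext j
  by_cases hj : j = k
  · subst hj; simp [combine, hk]
  · simp [combine, update_of_ne hj]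

lemma update_combine_neg (y z : ℤ → ℤ) {k : ℤ} (hk : k ≤ 0) (v : ℤ) :
    update (combine y z) k v = combine y (update z k v) := by
  funext j
  by_cases hj : j = k
  · subst hj; simp [combine, show ¬ 1 ≤ j by omega]
  · simp [combine, update_of_ne hj]

lemma combine_of_pos (y z : ℤ → ℤ) {k : ℤ} (hk : 1 ≤ k) : combine y z k = y k := if_pos hk

lemma combine_of_nonpos (y z : ℤ → ℤ) {k : ℤ} (hk : k ≤ 0) : combine y z k = z k :=
  if_neg (by omega)

lemma wtOf_combine (a1 a2 : ℤ) {y z : ℤ → ℤ} (hy : FinP y) (hz : FinM z) :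
    wtOf a1 a2 (combine y z) = wtOf a1 a2 y + wtOf a1 a2 z := by
  have hc : combine y z = fun k => y k + z k := by
    funext k
    rcases le_or_gt 1 k with hk | hk
    · rw [combine_of_pos _ _ hk, hz.1 k hk, add_zero]
    · rw [combine_of_nonpos _ _ (by omega), hy.1 k (by omega), zero_add]
  have hf : ∀ (x w : ℤ → ℤ), (support x).Finite → (support fun j => x j * w j).Finite :=
    fun x w hx => hx.subset fun j hj => left_ne_zero_of_mul hj
  have key : ∀ w : ℤ → ℤ, ∑ᶠ j, (y j + z j) * w j = ∑ᶠ j, y j * w j + ∑ᶠ j, z j * w j := by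
    intro w
    simp_rw [add_mul]
    exact finsum_add_distrib (hf y w hy.finite_support) (hf z w hz.finite_support)
  unfold wtOf
  rw [hc, key, key, Prod.mk_add_mk]
  congr 1 <;> ring

lemma sigmaZ_of_pos (a1 a2 : ℤ) (μ : ℤ × ℤ) (y z : ℤ → ℤ) {k : ℤ} (hk : 1 ≤ k) :
    sigmaZ a1 a2 μ (combine y z) k = sigmaP a1 a2 y k := by
  rw [sigmaZ, if_pos hk]
  unfold sigmaP
  rw [combine_of_pos _ _ hk]
  congr 1
  refine finsum_congr fun j => ?_
  split_ifs with h
  · rw [combine_of_pos _ _ (by omega)]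
  · rfl

lemma sigmaZ_of_nonpos (a1 a2 : ℤ) (μ : ℤ × ℤ) (y z : ℤ → ℤ) {k : ℤ} (hk : k ≤ 0) :
    sigmaZ a1 a2 μ (combine y z) k =
      sigmaM a1 a2 z k - pairW (wtZ a1 a2 μ (combine y z)) (idx k) := by
  rw [sigmaZ, if_neg (by omega)]
  congr 1
  unfold sigmaM
  rw [combine_of_nonpos _ _ hk]
  congr 1
  refine finsum_congr fun j => ?_
  split_ifs with h
  · rw [combine_of_nonpos _ _ (by omega)]
  · rfl

section Zcrystal

variable {a1 a2 : ℤ} {μ : ℤ × ℤ} {y z : ℤ → ℤ} (hy : FinP y) (hz : FinM z) {i : ℤ} (hi : IsI i)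
include hy hz hi

lemma epsZ_combine :
    epsZ a1 a2 μ (combine y z) i = max (epsP a1 a2 y i)
      (phiMf a1 a2 z i - pairW (wtZ a1 a2 μ (combine y z)) i) := by
  obtain ⟨⟨k, hk, hki, hks⟩, h1⟩ := epsP_isGreatest a1 a2 hy hi
  obtain ⟨⟨l, hl, hli, hls⟩, h2⟩ := phiMf_isGreatest a1 a2 hz hi
  refine IsGreatest.csSup_eq ⟨?_, ?_⟩
  · rcases max_choice (epsP a1 a2 y i)
      (phiMf a1 a2 z i - pairW (wtZ a1 a2 μ (combine y z)) i) with h | h <;> rw [h]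
    · exact ⟨k, hki, by rw [sigmaZ_of_pos _ _ _ _ _ hk, hks]⟩
    · exact ⟨l, hli, by rw [sigmaZ_of_nonpos _ _ _ _ _ hl, hls, hli]⟩
  · rintro s ⟨m, rfl, rfl⟩
    rcases le_or_gt 1 m with hm | hm
    · rw [sigmaZ_of_pos _ _ _ _ _ hm]
      exact le_max_of_le_left (h1 ⟨m, hm, rfl, rfl⟩)
    · rw [sigmaZ_of_nonpos _ _ _ _ _ (by omega)]
      exact le_max_of_le_right (sub_le_sub_right (h2 ⟨m, by omega, rfl, rfl⟩) _)

lemma eZ_eq_none_iff :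
    eZ a1 a2 μ i (combine y z) = none ↔
      epsP a1 a2 y i ≤ 0 ∧ phiMf a1 a2 z i ≤ pairW (wtZ a1 a2 μ (combine y z)) i := by
  rw [eZ, epsZ_combine hy hz hi]
  simp only [ite_eq_right_iff, reduceCtorEq, imp_false, not_lt, max_le_iff, sub_nonpos]

lemma fZ_eq_none_iff :
    fZ a1 a2 μ i (combine y z) = none ↔
      epsP a1 a2 y i ≤ -pairW (wtZ a1 a2 μ (combine y z)) i ∧ phiMf a1 a2 z i ≤ 0 := by
  rw [fZ, phiZ, epsZ_combine hy hz hi]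
  simp only [ite_eq_right_iff, reduceCtorEq, imp_false, not_lt]
  rw [← le_neg_iff_add_nonpos_right, max_le_iff]
  constructor <;> rintro ⟨h1, h2⟩ <;> constructor <;> linarith

lemma eZ_combine_pos {m : ℤ} (hpos : 0 < epsP a1 a2 y i)
    (hle : phiMf a1 a2 z i - pairW (wtZ a1 a2 μ (combine y z)) i ≤ epsP a1 a2 y i)
    (hm : IsGreatest {k : ℤ | 1 ≤ k ∧ idx k = i ∧ sigmaP a1 a2 y k = epsP a1 a2 y i} m) :
    eZ a1 a2 μ i (combine y z) = some (combine (update y m (y m - 1)) z) := by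
  have he := (epsZ_combine (a1 := a1) (a2 := a2) (μ := μ) hy hz hi).trans (max_eq_left hle)
  obtain ⟨⟨h1, h2, h3⟩, h4⟩ := hm
  have hk : kmaxZ a1 a2 μ (combine y z) i = m := by
    refine IsGreatest.csSup_eq ⟨⟨h2, by rw [he, sigmaZ_of_pos _ _ _ _ _ h1, h3]⟩, ?_⟩
    rintro k ⟨hki, hks⟩
    rcases le_or_gt 1 k with hk | hk
    · rw [he, sigmaZ_of_pos _ _ _ _ _ hk] at hks
      exact h4 ⟨hk, hki, hks⟩
    · omega
  rw [eZ, he, if_pos hpos, hk, combine_of_pos _ _ h1, update_combine_pos _ _ h1]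

lemma eZ_combine_neg
    (hpos : 0 < phiMf a1 a2 z i - pairW (wtZ a1 a2 μ (combine y z)) i)
    (hlt : epsP a1 a2 y i < phiMf a1 a2 z i - pairW (wtZ a1 a2 μ (combine y z)) i) :
    eZ a1 a2 μ i (combine y z) = some (combine y (eM a1 a2 i z)) := by
  have he := (epsZ_combine (a1 := a1) (a2 := a2) (μ := μ) hy hz hi).trans (max_eq_right hlt.le)
  have hm := kmaxM_isGreatest a1 a2 hz hi
  rw [← kmaxM_eq a1 a2 hz hi] at hm
  obtain ⟨⟨h1, h2, h3⟩, h4⟩ := hm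
  have hk : kmaxZ a1 a2 μ (combine y z) i = kmaxM a1 a2 z i := by
    refine IsGreatest.csSup_eq ⟨⟨h2, by rw [he, sigmaZ_of_nonpos _ _ _ _ _ h1, h3, h2]⟩, ?_⟩
    rintro k ⟨rfl, hks⟩
    rcases le_or_gt 1 k with hk | hk
    · rw [he, sigmaZ_of_pos _ _ _ _ _ hk] at hks
      have := sigmaP_le_epsP a1 a2 hy hk
      omega
    · rw [he, sigmaZ_of_nonpos _ _ _ _ _ (by omega)] at hks
      exact h4 ⟨by omega, rfl, by omega⟩
  rw [eZ, he, if_pos hpos, hk, combine_of_nonpos _ _ h1, update_combine_neg _ _ h1, eM]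

lemma fZ_combine_pos
    (hpos : 0 < epsP a1 a2 y i + pairW (wtZ a1 a2 μ (combine y z)) i)
    (hlt : phiMf a1 a2 z i - pairW (wtZ a1 a2 μ (combine y z)) i < epsP a1 a2 y i) :
    fZ a1 a2 μ i (combine y z) = some (combine (fP a1 a2 i y) z) := by
  have he := (epsZ_combine (a1 := a1) (a2 := a2) (μ := μ) hy hz hi).trans (max_eq_left hlt.le)
  obtain ⟨⟨h1, h2, h3⟩, h4⟩ := kminP_isLeast a1 a2 hy hi
  have hk : kminZ a1 a2 μ (combine y z) i = kminP a1 a2 y i := by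
    refine IsLeast.csInf_eq ⟨⟨h2, by rw [he, sigmaZ_of_pos _ _ _ _ _ h1, h3]⟩, ?_⟩
    rintro k ⟨rfl, hks⟩
    rcases le_or_gt 1 k with hk | hk
    · rw [he, sigmaZ_of_pos _ _ _ _ _ hk] at hks
      exact h4 ⟨hk, rfl, hks⟩
    · rw [he, sigmaZ_of_nonpos _ _ _ _ _ (by omega)] at hks
      have := (phiMf_isGreatest a1 a2 hz hi).2 ⟨k, by omega, rfl, rfl⟩
      omega
  rw [fZ, phiZ, he, if_pos hpos, hk, combine_of_pos _ _ h1, update_combine_pos _ _ h1, fP]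

lemma fZ_combine_neg {m : ℤ} (hpos : 0 < phiMf a1 a2 z i)
    (hle : epsP a1 a2 y i ≤ phiMf a1 a2 z i - pairW (wtZ a1 a2 μ (combine y z)) i)
    (hm : IsLeast {k : ℤ | k ≤ 0 ∧ idx k = i ∧ sigmaM a1 a2 z k = phiMf a1 a2 z i} m) :
    fZ a1 a2 μ i (combine y z) = some (combine y (update z m (z m + 1))) := by
  have he := (epsZ_combine (a1 := a1) (a2 := a2) (μ := μ) hy hz hi).trans (max_eq_right hle)
  obtain ⟨⟨h1, h2, h3⟩, h4⟩ := hm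
  have hk : kminZ a1 a2 μ (combine y z) i = m := by
    refine IsLeast.csInf_eq ⟨⟨h2, by rw [he, sigmaZ_of_nonpos _ _ _ _ _ h1, h3, h2]⟩, ?_⟩
    rintro k ⟨rfl, hks⟩
    rcases le_or_gt 1 k with hk | hk
    · omega
    · rw [he, sigmaZ_of_nonpos _ _ _ _ _ (by omega)] at hks
      exact h4 ⟨by omega, rfl, by omega⟩
  rw [fZ, phiZ, he, if_pos (by omega), hk, combine_of_nonpos _ _ h1, update_combine_neg _ _ h1]

end Zcrystal

/-! ### Strings in `Z_ι(μ)` -/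

section Strings

variable {a1 a2 : ℤ} {μ : ℤ × ℤ} {y z : ℤ → ℤ} (hy : FinP y) (hz : FinM z) {i : ℤ} (hi : IsI i)
include hy hz hi

lemma pairW_wtZ_string (a b : ℕ) :
    pairW (wtZ a1 a2 μ (combine (fPiter a1 a2 i a y) (eMiter a1 a2 i b z))) i =
      pairW (wtZ a1 a2 μ (combine y z)) i - 2 * a + 2 * b := by
  obtain ⟨κ, -, rfl⟩ := exists_idx_eq hi 0
  unfold wtZ
  rw [wtOf_combine a1 a2 (hy.fPiter a1 a2 hi a) (hz.eMiter a1 a2 hi b), wtOf_combine a1 a2 hy hz,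
    wtOf_fPiter a1 a2 hy, wtOf_eMiter a1 a2 hz, sub_eq_add_neg, ← neg_smul]
  simp only [pairW_add, pairW_zsmul, pairW_alphaOf_self]
  ring

variable (hy0 : epsP a1 a2 y i = 0) (hz0 : phiMf a1 a2 z i = 0)
include hy0 hz0

lemma eZ_string_neg (a b : ℕ)
    (hlt : (a : ℤ) < b - pairW (wtZ a1 a2 μ (combine (fPiter a1 a2 i a y) (eMiter a1 a2 i b z))) i) :
    eZ a1 a2 μ i (combine (fPiter a1 a2 i a y) (eMiter a1 a2 i b z)) =
      some (combine (fPiter a1 a2 i a y) (eMiter a1 a2 i (b + 1) z)) := by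
  have h1 := epsP_fPiter a1 a2 hy hi hy0 a
  have h2 := phiMf_eMiter a1 a2 hz hi hz0 b
  rw [eMiter_succ]
  exact eZ_combine_neg (hy.fPiter a1 a2 hi a) (hz.eMiter a1 a2 hi b) hi
    (by rw [h2]; omega) (by rw [h1, h2]; omega)

lemma eZ_string_pos (a b : ℕ)
    (hle : b - pairW (wtZ a1 a2 μ (combine (fPiter a1 a2 i (a + 1) y) (eMiter a1 a2 i b z))) i ≤
      (a : ℤ) + 1) :
    eZ a1 a2 μ i (combine (fPiter a1 a2 i (a + 1) y) (eMiter a1 a2 i b z)) =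
      some (combine (fPiter a1 a2 i a y) (eMiter a1 a2 i b z)) := by
  have h1 := epsP_fPiter a1 a2 hy hi hy0 (a + 1)
  have h2 := phiMf_eMiter a1 a2 hz hi hz0 b
  have h3 := kminP_fPiter_isGreatest a1 a2 hy hi hy0 a
  push_cast at h1
  rw [eZ_combine_pos (hy.fPiter a1 a2 hi (a + 1)) (hz.eMiter a1 a2 hi b) hi
    (by rw [h1]; omega) (by rw [h1, h2]; exact hle) (by rw [h1]; exact h3)]
  rw [fPiter_succ, fP]
  simp

lemma fZ_string_pos (a b : ℕ)
    (hpos : 0 < a + pairW (wtZ a1 a2 μ (combine (fPiter a1 a2 i a y) (eMiter a1 a2 i b z))) i)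
    (hlt : b - pairW (wtZ a1 a2 μ (combine (fPiter a1 a2 i a y) (eMiter a1 a2 i b z))) i < (a : ℤ)) :
    fZ a1 a2 μ i (combine (fPiter a1 a2 i a y) (eMiter a1 a2 i b z)) =
      some (combine (fPiter a1 a2 i (a + 1) y) (eMiter a1 a2 i b z)) := by
  have h1 := epsP_fPiter a1 a2 hy hi hy0 a
  have h2 := phiMf_eMiter a1 a2 hz hi hz0 b
  rw [fPiter_succ]
  exact fZ_combine_pos (hy.fPiter a1 a2 hi a) (hz.eMiter a1 a2 hi b) hi
    (by rw [h1]; exact hpos) (by rw [h1, h2]; exact hlt)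

lemma fZ_string_neg (a b : ℕ)
    (hle : (a : ℤ) ≤ b + 1 -
      pairW (wtZ a1 a2 μ (combine (fPiter a1 a2 i a y) (eMiter a1 a2 i (b + 1) z))) i) :
    fZ a1 a2 μ i (combine (fPiter a1 a2 i a y) (eMiter a1 a2 i (b + 1) z)) =
      some (combine (fPiter a1 a2 i a y) (eMiter a1 a2 i b z)) := by
  have h1 := epsP_fPiter a1 a2 hy hi hy0 a
  have h2 := phiMf_eMiter a1 a2 hz hi hz0 (b + 1)
  have h3 := kmaxM_eMiter_isLeast a1 a2 hz hi hz0 b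
  push_cast at h2
  rw [fZ_combine_neg (hy.fPiter a1 a2 hi a) (hz.eMiter a1 a2 hi (b + 1)) hi
    (by rw [h2]; omega) (by rw [h1, h2]; exact hle) (by rw [h2]; exact h3)]
  rw [eMiter_succ, eM]
  simp

variable {a b : ℕ} (hw : pairW (wtZ a1 a2 μ (combine y z)) i = a - b)
include hw

lemma eZiterO_string :
    eZiterO a1 a2 μ i (a + b) (some (combine (fPiter a1 a2 i a y) z)) =
      some (combine y (eMiter a1 a2 i b z)) := by
  have hW := pairW_wtZ_string (a1 := a1) (a2 := a2) (μ := μ) hy hz hi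
  have h1 : ∀ n : ℕ, n ≤ b → eZiterO a1 a2 μ i n (some (combine (fPiter a1 a2 i a y) z)) =
      some (combine (fPiter a1 a2 i a y) (eMiter a1 a2 i n z)) := by
    intro n
    induction n with
    | zero => intro _; rfl
    | succ n ih =>
      intro hn
      rw [eZiterO, iterate_succ_apply', ← eZiterO, ih (by omega), Option.bind_some,
        eZ_string_neg hy hz hi hy0 hz0 _ _ (by rw [hW, hw]; omega)]
  have h2 : ∀ n m : ℕ, n + m = a →
      eZiterO a1 a2 μ i (b + n) (some (combine (fPiter a1 a2 i a y) z)) =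
        some (combine (fPiter a1 a2 i m y) (eMiter a1 a2 i b z)) := by
    intro n
    induction n with
    | zero => intro m hm; rw [show m = a by omega]; exact h1 b le_rfl
    | succ n ih =>
      intro m hm
      rw [← add_assoc, eZiterO, iterate_succ_apply', ← eZiterO, ih (m + 1) (by omega),
        Option.bind_some, eZ_string_pos hy hz hi hy0 hz0 _ _ (by rw [hW, hw]; push_cast; omega)]
  rw [add_comm]
  exact h2 a 0 rfl

lemma fZiterO_string :
    fZiterO a1 a2 μ i (a + b) (some (combine y (eMiter a1 a2 i b z))) =
      some (combine (fPiter a1 a2 i a y) z) := by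
  have hW := pairW_wtZ_string (a1 := a1) (a2 := a2) (μ := μ) hy hz hi
  have h1 : ∀ n : ℕ, n ≤ a → fZiterO a1 a2 μ i n (some (combine y (eMiter a1 a2 i b z))) =
      some (combine (fPiter a1 a2 i n y) (eMiter a1 a2 i b z)) := by
    intro n
    induction n with
    | zero => intro _; rfl
    | succ n ih =>
      intro hn
      rw [fZiterO, iterate_succ_apply', ← fZiterO, ih (by omega), Option.bind_some,
        fZ_string_pos hy hz hi hy0 hz0 _ _ (by rw [hW, hw]; omega) (by rw [hW, hw]; omega)]
  have h2 : ∀ n m : ℕ, n + m = b →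
      fZiterO a1 a2 μ i (a + n) (some (combine y (eMiter a1 a2 i b z))) =
        some (combine (fPiter a1 a2 i a y) (eMiter a1 a2 i m z)) := by
    intro n
    induction n with
    | zero => intro m hm; rw [show m = b by omega]; exact h1 a le_rfl
    | succ n ih =>
      intro m hm
      rw [← add_assoc, fZiterO, iterate_succ_apply', ← fZiterO, ih (m + 1) (by omega),
        Option.bind_some, fZ_string_neg hy hz hi hy0 hz0 _ _ (by rw [hW, hw]; push_cast; omega)]
  exact h2 b 0 rfl

variable (hpos : 0 < a + b)
include hpos

lemma SiO_string_left :
    SiO a1 a2 μ i (some (combine (fPiter a1 a2 i a y) z)) =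
      some (combine y (eMiter a1 a2 i b z)) := by
  have hW := pairW_wtZ_string (a1 := a1) (a2 := a2) (μ := μ) hy hz hi a 0
  rw [show eMiter a1 a2 i 0 z = z from rfl, hw] at hW
  rw [SiO, Option.bind_some, if_neg (by omega), hW,
    show (-((a : ℤ) - b - 2 * a + 2 * (0 : ℕ))).toNat = a + b by omega]
  exact eZiterO_string hy hz hi hy0 hz0 hw

omit hpos in
lemma SiO_string_right :
    SiO a1 a2 μ i (some (combine y (eMiter a1 a2 i b z))) =
      some (combine (fPiter a1 a2 i a y) z) := by
  have hW := pairW_wtZ_string (a1 := a1) (a2 := a2) (μ := μ) hy hz hi 0 b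
  rw [show fPiter a1 a2 i 0 y = y from rfl, hw] at hW
  rw [SiO, Option.bind_some, if_pos (by omega), hW,
    show ((a : ℤ) - b - 2 * (0 : ℕ) + 2 * b).toNat = a + b by omega]
  exact fZiterO_string hy hz hi hy0 hz0 hw

end Strings

end HypCrystal

namespace HypCrystal

/-! ### The sequence `p_m` -/

lemma pseq_add_two (a1 a2 k1 k2 m : ℤ) :
    pseq a1 a2 k1 k2 (m + 2) =
      aIdx a1 a2 m * pseq a1 a2 k1 k2 (m + 1) - pseq a1 a2 k1 k2 m := by
  rcases le_or_gt 0 m with hm | hm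
  · obtain ⟨n, rfl⟩ := Int.eq_ofNat_of_zero_le hm
    unfold pseq
    rw [if_pos (by omega), if_pos (by omega), if_pos hm, show ((n : ℤ) + 2).toNat = n + 2 by omega,
      show ((n : ℤ) + 1).toNat = n + 1 by omega, show ((n : ℤ)).toNat = n by omega, ppos, aIdx]
    congr 2
    split_ifs <;> first | rfl | omega
  · obtain ⟨n, rfl⟩ : ∃ n : ℕ, m = -(n + 1) := ⟨(-m - 1).toNat, by omega⟩
    rcases n with _ | _ | n
    · have h : aIdx a1 a2 (-((0 : ℕ) + 1)) = a1 := rfl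
      rw [h]
      simp [pseq, ppos, pneg]
    · have h : aIdx a1 a2 (-((0 + 1 : ℕ) + 1)) = a2 := rfl
      rw [h]
      simp [pseq, ppos, pneg]
    · unfold pseq
      rw [if_neg (by omega), if_neg (by omega), if_neg (by omega),
        show (-(-(((n + 1 + 1 : ℕ) : ℤ) + 1))).toNat = n + 1 + 2 by omega,
        show (-(-(((n + 1 + 1 : ℕ) : ℤ) + 1) + 1)).toNat = n + 2 by omega,
        show (-(-(((n + 1 + 1 : ℕ) : ℤ) + 1) + 2)).toNat = n + 1 by omega, aIdx]
      have h : (if (n + 1 + 2) % 2 = 0 then a2 else a1) =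
          if -(((n + 1 + 1 : ℕ) : ℤ) + 1) % 2 = 1 then a1 else a2 := by
        split_ifs <;> first | rfl | omega
      have h' : pneg a1 a2 k1 k2 (n + 1 + 2) = (if (n + 1 + 2) % 2 = 0 then a2 else a1) *
          pneg a1 a2 k1 k2 (n + 2) - pneg a1 a2 k1 k2 (n + 1) := rfl
      rw [h', h]; ring

lemma pos_of_two_le_coeff {s A : ℕ → ℤ} (hA : ∀ n, 2 ≤ A n)
    (hs : ∀ n, s (n + 2) = A n * s (n + 1) - s n) (h0 : 0 < s 0) (h1 : s 0 ≤ s 1) (n : ℕ) :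
    0 < s n := by
  have key : ∀ n, 0 < s n ∧ s n ≤ s (n + 1) := by
    intro n
    induction n with
    | zero => exact ⟨h0, h1⟩
    | succ n ih =>
      refine ⟨by omega, ?_⟩
      have := mul_nonneg (sub_nonneg.2 (hA n)) (show 0 ≤ s (n + 1) by omega)
      rw [hs n]; nlinarith
  exact (key n).1

lemma pos_of_one_coeff {s : ℕ → ℤ} {A : ℤ} (hA : 4 ≤ A)
    (hs : ∀ n, s (2 * n + 2) = s (2 * n + 1) - s (2 * n))
    (hs' : ∀ n, s (2 * n + 3) = A * s (2 * n + 2) - s (2 * n + 1))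
    (h0 : 0 < s 0) (h1 : 2 * s 0 ≤ s 1) (n : ℕ) : 0 < s n := by
  have key : ∀ n, 0 < s (2 * n) ∧ 2 * s (2 * n) ≤ s (2 * n + 1) := by
    intro n
    induction n with
    | zero => exact ⟨h0, h1⟩
    | succ n ih =>
      have e1 := hs n
      have e2 := hs' n
      rw [show 2 * (n + 1) = 2 * n + 2 by ring]
      refine ⟨by omega, ?_⟩
      have := mul_nonneg (sub_nonneg.2 hA) (show 0 ≤ s (2 * n + 2) by omega)
      rw [show 2 * n + 2 + 1 = 2 * n + 3 by ring, e2]; nlinarith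
  obtain ⟨m, rfl | rfl⟩ := Nat.even_or_odd' n
  · exact (key m).1
  · have := key m; omega

lemma pseq_pos {a1 a2 k1 k2 : ℤ} (ha1 : 1 ≤ a1) (ha2 : 1 ≤ a2) (ha : 4 < a1 * a2)
    (hk1 : 0 < k1) (hk2 : 0 < k2)
    (hreg : 2 ≤ a1 → 2 ≤ a2 →
      (k2 ≤ k1 ∧ k1 < (a1 - 1) * k2) ∨ (k1 < k2 ∧ k2 ≤ (a2 - 1) * k1))
    (hdeg1 : a1 = 1 → 2 * k1 ≤ k2 ∧ k2 ≤ (a2 - 2) * k1)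
    (hdeg2 : a2 = 1 → 2 * k2 ≤ k1 ∧ k1 ≤ (a1 - 2) * k2) (m : ℤ) :
    0 < pseq a1 a2 k1 k2 m := by
  have hrec := pseq_add_two a1 a2 k1 k2
  have h0 : pseq a1 a2 k1 k2 0 = k2 := rfl
  have h1 : pseq a1 a2 k1 k2 1 = k1 := rfl
  have h2 : pseq a1 a2 k1 k2 2 = a2 * k1 - k2 := rfl
  have h3 : pseq a1 a2 k1 k2 (-1) = a1 * k2 - k1 := rfl
  have hodd : ∀ m : ℤ, m % 2 = 1 → aIdx a1 a2 m = a1 := fun m h => if_pos h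
  have heven : ∀ m : ℤ, m % 2 = 0 → aIdx a1 a2 m = a2 := fun m h => if_neg (by omega)
  generalize pseq a1 a2 k1 k2 = p at *
  suffices h : (∀ n : ℕ, 0 < p (n + 1)) ∧ ∀ n : ℕ, 0 < p (-n) by
    rcases le_or_gt m 0 with hm | hm
    · rw [show m = -((-m).toNat : ℕ) by omega]; exact h.2 _
    · rw [show m = ((m - 1).toNat : ℕ) + 1 by omega]; exact h.1 _
  have hback : ∀ m, p m = aIdx a1 a2 m * p (m + 1) - p (m + 2) := fun m => by rw [hrec]; ring
  rcases eq_or_lt_of_le ha1 with e1 | e1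
  · obtain ⟨e2, e3⟩ := hdeg1 e1.symm
    subst e1
    constructor
    · refine pos_of_one_coeff (s := fun n => p (n + 1)) (A := a2) (by omega) (fun n => ?_)
        (fun n => ?_) (by simpa [h1]) ?_
      · have := hrec (2 * n + 1)
        rw [hodd _ (by omega), one_mul] at this
        push_cast; convert this using 2; ring_nf
      · have := hrec (2 * n + 2)
        rw [heven _ (by omega)] at this
        push_cast; convert this using 2 <;> ring_nf
      · show 2 * p 1 ≤ p 2
        rw [h1, h2]; linarith
    · have key : ∀ n : ℕ, 0 < p (1 - n) := by
        refine pos_of_one_coeff (s := fun n => p (1 - n)) (A := a2) (by omega) (fun n => ?_)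
          (fun n => ?_) (by simpa [h1]) ?_
        · have := hback (-(2 * n) - 1)
          rw [hodd _ (by omega), one_mul] at this
          push_cast; convert this using 2 <;> ring_nf
        · have := hback (-(2 * n) - 2)
          rw [heven _ (by omega)] at this
          push_cast; convert this using 2 <;> ring_nf
        · show 2 * p 1 ≤ p 0
          rw [h1, h0]; linarith
      intro n
      have := key (n + 1)
      rwa [show (1 : ℤ) - (n + 1 : ℕ) = -n by push_cast; ring] at this
  rcases eq_or_lt_of_le ha2 with e2 | e2
  · obtain ⟨e3, e4⟩ := hdeg2 e2.symm
    subst e2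
    constructor
    · have key : ∀ n : ℕ, 0 < p n := by
        refine pos_of_one_coeff (s := fun n => p n) (A := a1) (by omega) (fun n => ?_)
          (fun n => ?_) (by simpa [h0]) ?_
        · have := hrec (2 * n)
          rw [heven _ (by omega), one_mul] at this
          push_cast; convert this using 2
        · have := hrec (2 * n + 1)
          rw [hodd _ (by omega)] at this
          push_cast; convert this using 2 <;> ring_nf
        · show 2 * p 0 ≤ p 1
          rw [h1, h0]; linarith
      intro n
      have := key (n + 1)
      push_cast at this; exact this
    · refine pos_of_one_coeff (s := fun n => p (-n)) (A := a1) (by omega) (fun n => ?_)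
        (fun n => ?_) (by simpa [h0]) ?_
      · have := hback (-(2 * n) - 2)
        rw [heven _ (by omega), one_mul] at this
        push_cast; convert this using 2 <;> ring_nf
      · have := hback (-(2 * n) - 3)
        rw [hodd _ (by omega)] at this
        push_cast; convert this using 2 <;> ring_nf
      · show 2 * p 0 ≤ p (-1)
        rw [h3, h0]; linarith
  have hA : ∀ m, 2 ≤ aIdx a1 a2 m := fun m => by unfold aIdx; split_ifs <;> omega
  have hr := hreg (by omega) (by omega)
  constructor
  · refine pos_of_two_le_coeff (s := fun n => p (n + 1)) (A := fun n => aIdx a1 a2 (n + 1))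
      (fun n => hA _) (fun n => ?_) (by simpa [h1]) ?_
    · have := hrec (n + 1)
      push_cast; convert this using 2; ring_nf
    · show p 1 ≤ p 2
      rw [h1, h2]; rcases hr with ⟨r1, r2⟩ | ⟨r1, r2⟩ <;> nlinarith
  · refine pos_of_two_le_coeff (s := fun n => p (-n)) (A := fun n => aIdx a1 a2 (-n - 2))
      (fun n => hA _) (fun n => ?_) (by simpa [h0]) ?_
    · have := hback (-n - 2)
      push_cast; convert this using 2 <;> ring_nf
    · show p 0 ≤ p (-1)
      rw [h0, h3]; rcases hr with ⟨r1, r2⟩ | ⟨r1, r2⟩ <;> nlinarith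

/-! ### Weights of the chains and the `∗`-operation -/

lemma IsChainP.wtOf_eq {a1 a2 : ℤ} {u : ℤ → ℤ} {Y : ℤ → ℤ → ℤ} (hY : IsChainP a1 a2 u Y)
    {k N : ℤ} (hu : ∀ j, k < j → 0 ≤ u j) (hN : ∀ j, N < j → u j = 0) :
    wtOf a1 a2 (Y k) = wtOf a1 a2 (fun j => if k < j then u j else 0) := by
  have hfin : ∀ m : ℤ, (support fun j => if m < j then u j else 0).Finite := fun m => by
    refine (Set.finite_Ioc m N).subset fun j hj => ?_
    by_contra h
    rw [Set.mem_Ioc, not_and_or] at h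
    refine hj ?_
    by_cases hm : m < j
    · show (if m < j then u j else 0) = 0
      rw [if_pos hm, hN j (by omega)]
    · exact if_neg hm
  have hstep : ∀ n : ℕ, wtOf a1 a2 (Y k) - wtOf a1 a2 (fun j => if k < j then u j else 0) =
      wtOf a1 a2 (Y (k + n)) - wtOf a1 a2 (fun j => if k + n < j then u j else 0) := by
    intro n
    induction n with
    | zero => simp
    | succ n ih =>
      have h1 : wtOf a1 a2 (fun j => if k + n < j then u j else 0) =
          wtOf a1 a2 (fun j => if k + n + 1 < j then u j else 0) -
            u (k + n + 1) • alphaOf a1 a2 (k + n + 1) := by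
        rw [← wtOf_update a1 a2 (hfin _)]
        congr 1
        funext j
        by_cases hj : j = k + n + 1
        · subst hj; simp
        · rw [update_of_ne hj]; congr 1; rw [eq_iff_iff]; omega
      rw [ih, hY.step (k + n), wtOf_fPiter a1 a2 (hY.fin _), h1,
        Int.toNat_of_nonneg (hu _ (by omega))]
      push_cast
      rw [← add_assoc]; abel
  obtain ⟨M, hM⟩ := hY.zero
  obtain ⟨n, hn1, hn2⟩ : ∃ n : ℕ, M ≤ k + n ∧ N ≤ k + n :=
    ⟨(M - k).toNat + (N - k).toNat, by omega, by omega⟩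
  have h := hstep n
  rw [hM (k + n) hn1] at h
  have h0 : (fun j => if k + n < j then u j else 0) =
      fun _ => 0 := by
    funext j
    split_ifs with hj
    · exact hN j (by omega)
    · rfl
  rw [h0, sub_self] at h
  exact sub_eq_zero.1 h

lemma IsChainM.wtOf_eq {a1 a2 : ℤ} {v : ℤ → ℤ} {Z : ℤ → ℤ → ℤ} (hZ : IsChainM a1 a2 v Z)
    {k N : ℤ} (hv : ∀ j, j ≤ k → 0 ≤ v j) (hN : ∀ j, j < N → v j = 0) :
    wtOf a1 a2 (Z k) = wtOf a1 a2 (fun j => if j ≤ k then -v j else 0) := by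
  have hfin : ∀ m : ℤ, (support fun j => if j ≤ m then -v j else 0).Finite := fun m => by
    refine (Set.finite_Icc N m).subset fun j hj => ?_
    by_contra h
    rw [Set.mem_Icc, not_and_or] at h
    refine hj ?_
    by_cases hm : j ≤ m
    · show (if j ≤ m then -v j else 0) = 0
      rw [if_pos hm, hN j (by omega), neg_zero]
    · exact if_neg hm
  have hstep : ∀ n : ℕ, wtOf a1 a2 (Z k) - wtOf a1 a2 (fun j => if j ≤ k then -v j else 0) =
      wtOf a1 a2 (Z (k - n)) - wtOf a1 a2 (fun j => if j ≤ k - n then -v j else 0) := by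
    intro n
    induction n with
    | zero => simp
    | succ n ih =>
      have h1 : wtOf a1 a2 (fun j => if j ≤ k - n then -v j else 0) =
          wtOf a1 a2 (fun j => if j ≤ k - (n + 1 : ℕ) then -v j else 0) -
            (-v (k - n)) • alphaOf a1 a2 (k - n) := by
        rw [← wtOf_update a1 a2 (hfin _)]
        congr 1
        funext j
        by_cases hj : j = k - n
        · subst hj; simp; omega
        · rw [update_of_ne hj]; congr 1; rw [eq_iff_iff]; push_cast; omega
      have h2 := hZ.step (k - (n + 1 : ℕ))
      rw [show k - ((n + 1 : ℕ) : ℤ) + 1 = k - n by push_cast; ring] at h2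
      rw [ih, h2, wtOf_eMiter a1 a2 (hZ.fin _), h1, Int.toNat_of_nonneg (hv _ (by omega)), neg_smul]
      abel
  obtain ⟨M, hM⟩ := hZ.zero
  obtain ⟨n, hn1, hn2⟩ : ∃ n : ℕ, k - n ≤ M ∧ k - n < N :=
    ⟨(k - M).toNat + (k - N + 1).toNat, by omega, by omega⟩
  have h := hstep n
  rw [hM (k - n) hn1] at h
  have h0 : (fun j => if j ≤ k - n then -v j else 0) =
      fun _ => 0 := by
    funext j
    split_ifs with hj
    · rw [hN j (by omega), neg_zero]
    · rfl
  rw [h0, sub_self] at h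
  exact sub_eq_zero.1 h

lemma IsChainP.starPChain_eq {a1 a2 : ℤ} {u : ℤ → ℤ} {Y : ℤ → ℤ → ℤ} (hY : IsChainP a1 a2 u Y)
    {x : ℤ → ℤ} (hx : ∀ k, 1 ≤ k → x k = u k) (n : ℕ) : starPChain a1 a2 x n (Y n) = Y 0 := by
  induction n with
  | zero => rfl
  | succ n ih =>
    rw [starPChain, hx _ (by omega)]
    push_cast
    rw [← hY.step, ih]

lemma IsChainM.starMChain_eq {a1 a2 : ℤ} {v : ℤ → ℤ} {Z : ℤ → ℤ → ℤ} (hZ : IsChainM a1 a2 v Z)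
    {x : ℤ → ℤ} (hx : ∀ k, k ≤ 0 → -x k = v k) (n : ℕ) :
    starMChain a1 a2 x n (Z (-n)) = Z 0 := by
  induction n with
  | zero => rfl
  | succ n ih =>
    have h := hZ.step (-(n + 1 : ℕ))
    rw [show -((n + 1 : ℕ) : ℤ) + 1 = -n by push_cast; ring] at h
    rw [starMChain, hx _ (by omega), ← h, ih]

end HypCrystal

namespace HypCrystal

/-! ### Two-sided chains -/

/-- A pair of chains whose combined element at position `0` has the weight of an extremal vector
with string lengths `p`. -/
structure IsTwoChain (a1 a2 : ℤ) (μ : ℤ × ℤ) (p u v : ℤ → ℤ) (Y Z : ℤ → ℤ → ℤ) : Prop where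
  chainP : IsChainP a1 a2 u Y
  chainM : IsChainM a1 a2 v Z
  rec_eq : ∀ m, p (m + 2) = aIdx a1 a2 m * p (m + 1) - p m
  pos : ∀ m, 0 < p m
  sum : ∀ m, u m + v m = p m
  wt_succ : pairW (wtZ a1 a2 μ (combine (Y 0) (Z 0))) (idx 1) = -p 1
  wt_self : pairW (wtZ a1 a2 μ (combine (Y 0) (Z 0))) (idx 0) = p 0

/-- The weight of `Y_k ⊗ t_μ ⊗ Z_k` pairs to `p_k` and `−p_{k+1}` with the simple coroots. -/
def HasChainWt (a1 a2 : ℤ) (μ : ℤ × ℤ) (p : ℤ → ℤ) (Y Z : ℤ → ℤ → ℤ) (k : ℤ) : Prop :=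
  pairW (wtZ a1 a2 μ (combine (Y k) (Z k))) (idx (k + 1)) = -p (k + 1) ∧
    pairW (wtZ a1 a2 μ (combine (Y k) (Z k))) (idx k) = p k

/-- The element `b` is obtained from `b₀` by a sequence of operators `S_i`. -/
def Reach (a1 a2 : ℤ) (μ : ℤ × ℤ) (b₀ b : ℤ → ℤ) : Prop :=
  ∃ js : List ℤ, (∀ j ∈ js, IsI j) ∧ js.foldr (SiO a1 a2 μ) (some b₀) = some b

lemma Reach.step {a1 a2 : ℤ} {μ : ℤ × ℤ} {b₀ b b' : ℤ → ℤ} (h : Reach a1 a2 μ b₀ b) {i : ℤ}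
    (hi : IsI i) (hb : SiO a1 a2 μ i (some b) = some b') : Reach a1 a2 μ b₀ b' := by
  obtain ⟨js, h1, h2⟩ := h
  refine ⟨i :: js, ?_, by rw [List.foldr_cons, h2, hb]⟩
  intro j hj
  rcases List.mem_cons.1 hj with rfl | hj
  exacts [hi, h1 j hj]

lemma Extremal.of_reach {a1 a2 : ℤ} {μ : ℤ × ℤ} {b₀ b : ℤ → ℤ} (he : Extremal a1 a2 μ b₀)
    (h : Reach a1 a2 μ b₀ b) {i : ℤ} (hi : IsI i) :
    (0 ≤ pairW (wtZ a1 a2 μ b) i → eZ a1 a2 μ i b = none) ∧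
      (pairW (wtZ a1 a2 μ b) i ≤ 0 → fZ a1 a2 μ i b = none) := by
  obtain ⟨js, h1, h2⟩ := h
  obtain ⟨b', h3, h4⟩ := he js h1
  rw [h2, Option.some.injEq] at h3
  subst h3
  exact h4 i hi

lemma eq_idx_or_eq_idx_succ {i : ℤ} (hi : IsI i) (k : ℤ) : i = idx k ∨ i = idx (k + 1) := by
  unfold IsI at hi; unfold idx; split_ifs <;> omega

section TwoChain

variable {a1 a2 : ℤ} {μ : ℤ × ℤ} {p u v : ℤ → ℤ} {Y Z : ℤ → ℤ → ℤ}
  (h : IsTwoChain a1 a2 μ p u v Y Z)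
include h

lemma IsTwoChain.wtZ_succ {k : ℤ} (hu : 0 ≤ u (k + 1)) (hv : 0 ≤ v (k + 1)) :
    wtZ a1 a2 μ (combine (Y (k + 1)) (Z (k + 1))) =
      wtZ a1 a2 μ (combine (Y k) (Z k)) + p (k + 1) • alphaOf a1 a2 (k + 1) := by
  unfold wtZ
  rw [wtOf_combine a1 a2 (h.chainP.fin _) (h.chainM.fin _),
    wtOf_combine a1 a2 (h.chainP.fin _) (h.chainM.fin _), h.chainP.step k, h.chainM.step k,
    wtOf_fPiter a1 a2 (h.chainP.fin _), wtOf_eMiter a1 a2 (h.chainM.fin _),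
    Int.toNat_of_nonneg hu, Int.toNat_of_nonneg hv, ← h.sum, add_smul]
  abel

lemma IsTwoChain.hasChainWt_zero : HasChainWt a1 a2 μ p Y Z 0 := ⟨h.wt_succ, h.wt_self⟩

lemma IsTwoChain.hasChainWt_succ_iff {k : ℤ} (hu : 0 ≤ u (k + 1)) (hv : 0 ≤ v (k + 1)) :
    HasChainWt a1 a2 μ p Y Z (k + 1) ↔ HasChainWt a1 a2 μ p Y Z k := by
  unfold HasChainWt
  have hidx : idx (k + 1 + 1) = idx k := by rw [idx_eq_iff]; omega
  have hr := h.rec_eq k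
  rw [h.wtZ_succ hu hv, hidx, show k + 1 + 1 = k + 2 by ring, hr]
  simp only [pairW_add, pairW_zsmul, pairW_alphaOf_self, pairW_alphaOf_succ]
  constructor <;> rintro ⟨h1, h2⟩ <;> constructor <;> linarith

lemma IsTwoChain.weight_of_hasChainWt {k : ℤ} (hu : 0 ≤ u (k + 1)) (hv : 0 ≤ v (k + 1))
    (hw : HasChainWt a1 a2 μ p Y Z k) :
    pairW (wtZ a1 a2 μ (combine (Y (k + 1)) (Z k))) (idx (k + 1)) =
      (u (k + 1)).toNat - (v (k + 1)).toNat := by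
  have h1 := pairW_wtZ_string (a1 := a1) (a2 := a2) (μ := μ) (h.chainP.fin (k + 1)) (h.chainM.fin k)
    (isI_idx (k + 1)) (u (k + 1)).toNat 0
  rw [← h.chainP.step k, show eMiter a1 a2 (idx (k + 1)) 0 (Z k) = Z k from rfl, hw.1] at h1
  have h2 := h.sum (k + 1)
  omega

lemma IsTwoChain.SiO_up {k : ℤ} (hu : 0 ≤ u (k + 1)) (hv : 0 ≤ v (k + 1))
    (hY0 : epsP a1 a2 (Y (k + 1)) (idx (k + 1)) = 0)
    (hZ0 : phiMf a1 a2 (Z k) (idx (k + 1)) = 0) (hw : HasChainWt a1 a2 μ p Y Z k) :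
    SiO a1 a2 μ (idx (k + 1)) (some (combine (Y k) (Z k))) =
      some (combine (Y (k + 1)) (Z (k + 1))) := by
  rw [h.chainP.step k, h.chainM.step k]
  refine SiO_string_left (h.chainP.fin _) (h.chainM.fin _) (isI_idx _) hY0 hZ0
    (h.weight_of_hasChainWt hu hv hw) ?_
  have h1 := h.sum (k + 1)
  have h2 := h.pos (k + 1)
  omega

lemma IsTwoChain.SiO_down {k : ℤ} (hu : 0 ≤ u (k + 1)) (hv : 0 ≤ v (k + 1))
    (hY0 : epsP a1 a2 (Y (k + 1)) (idx (k + 1)) = 0)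
    (hZ0 : phiMf a1 a2 (Z k) (idx (k + 1)) = 0) (hw : HasChainWt a1 a2 μ p Y Z k) :
    SiO a1 a2 μ (idx (k + 1)) (some (combine (Y (k + 1)) (Z (k + 1)))) =
      some (combine (Y k) (Z k)) := by
  rw [h.chainP.step k, h.chainM.step k]
  exact SiO_string_right (h.chainP.fin _) (h.chainM.fin _) (isI_idx _) hY0 hZ0
    (h.weight_of_hasChainWt hu hv hw)

lemma IsTwoChain.extremal (hu : ∀ k, 0 ≤ u k) (hv : ∀ k, 0 ≤ v k)
    (hY0 : ∀ k, epsP a1 a2 (Y k) (idx k) = 0)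
    (hZ0 : ∀ k, phiMf a1 a2 (Z k) (idx (k + 1)) = 0) :
    Extremal a1 a2 μ (combine (Y 0) (Z 0)) := by
  have hw : ∀ k, HasChainWt a1 a2 μ p Y Z k := by
    intro k
    induction k using Int.induction_on with
    | zero => exact h.hasChainWt_zero
    | succ k ih => exact (h.hasChainWt_succ_iff (hu _) (hv _)).2 ih
    | pred k ih =>
      refine (h.hasChainWt_succ_iff (hu _) (hv _)).1 ?_
      rwa [sub_add_cancel]
  have hfold : ∀ js : List ℤ, (∀ j ∈ js, IsI j) →
      ∃ k, js.foldr (SiO a1 a2 μ) (some (combine (Y 0) (Z 0))) = some (combine (Y k) (Z k)) := by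
    intro js
    induction js with
    | nil => intro _; exact ⟨0, rfl⟩
    | cons i js ih =>
      intro hjs
      obtain ⟨k, hk⟩ := ih fun j hj => hjs j (List.mem_cons_of_mem _ hj)
      rw [List.foldr_cons, hk]
      rcases eq_idx_or_eq_idx_succ (hjs i List.mem_cons_self) k with rfl | rfl
      · obtain ⟨m, rfl⟩ : ∃ m, k = m + 1 := ⟨k - 1, by ring⟩
        exact ⟨m, h.SiO_down (hu _) (hv _) (hY0 _) (hZ0 _) (hw _)⟩
      · exact ⟨k + 1, h.SiO_up (hu _) (hv _) (hY0 _) (hZ0 _) (hw _)⟩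
  intro js hjs
  obtain ⟨k, hk⟩ := hfold js hjs
  refine ⟨_, hk, fun i hi => ?_⟩
  rw [eZ_eq_none_iff (h.chainP.fin _) (h.chainM.fin _) hi,
    fZ_eq_none_iff (h.chainP.fin _) (h.chainM.fin _) hi]
  rcases eq_idx_or_eq_idx_succ hi k with rfl | rfl
  · rw [(hw k).2, hY0]
    have h1 := h.pos k
    have h2 := h.sum k
    have h3 := hu k
    refine ⟨fun _ => ⟨le_rfl, ?_⟩, fun h' => absurd h' (by omega)⟩
    obtain ⟨m, rfl⟩ : ∃ m, k = m + 1 := ⟨k - 1, by ring⟩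
    rw [h.chainM.phiMf_eq (hv _) (hZ0 _)]
    omega
  · rw [(hw k).1, hZ0, h.chainP.epsP_eq (hu _) (hY0 _)]
    have h1 := h.pos (k + 1)
    have h2 := h.sum (k + 1)
    have h3 := hv (k + 1)
    exact ⟨fun h' => absurd h' (by omega), fun _ => ⟨by omega, le_rfl⟩⟩

section Converse

variable (hext : Extremal a1 a2 μ (combine (Y 0) (Z 0)))
include hext

lemma IsTwoChain.string_up (hu : ∀ k, 1 ≤ k → 0 ≤ u k)
    (hY0 : ∀ k, 1 ≤ k → epsP a1 a2 (Y k) (idx k) = 0) {k : ℤ} (hk : 0 ≤ k) :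
    0 ≤ v (k + 1) ∧ phiMf a1 a2 (Z k) (idx (k + 1)) = 0 := by
  have step : ∀ k : ℤ, 0 ≤ k → HasChainWt a1 a2 μ p Y Z k →
      Reach a1 a2 μ (combine (Y 0) (Z 0)) (combine (Y k) (Z k)) →
      0 ≤ v (k + 1) ∧ phiMf a1 a2 (Z k) (idx (k + 1)) = 0 := by
    intro k hk hw hr
    have h1 := (hext.of_reach hr (isI_idx (k + 1))).2
    have h2 := h.pos (k + 1)
    have h3 := h.sum (k + 1)
    rw [fZ_eq_none_iff (h.chainP.fin _) (h.chainM.fin _) (isI_idx _), hw.1,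
      h.chainP.epsP_eq (hu _ (by omega)) (hY0 _ (by omega))] at h1
    obtain ⟨h4, h5⟩ := h1 (by omega)
    exact ⟨by omega, le_antisymm h5 (phiMf_nonneg a1 a2 (h.chainM.fin k) (isI_idx _))⟩
  have key : ∀ n : ℕ, HasChainWt a1 a2 μ p Y Z n ∧
      Reach a1 a2 μ (combine (Y 0) (Z 0)) (combine (Y n) (Z n)) := by
    intro n
    induction n with
    | zero => exact ⟨h.hasChainWt_zero, [], by simp, rfl⟩
    | succ n ih =>
      obtain ⟨h1, h2⟩ := step n (by omega) ih.1 ih.2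
      push_cast
      exact ⟨(h.hasChainWt_succ_iff (hu _ (by omega)) h1).2 ih.1, ih.2.step (isI_idx _)
        (h.SiO_up (hu _ (by omega)) h1 (hY0 _ (by omega)) h2 ih.1)⟩
  obtain ⟨n, rfl⟩ := Int.eq_ofNat_of_zero_le hk
  exact step n hk (key n).1 (key n).2

lemma IsTwoChain.string_down (hv : ∀ k, k ≤ 0 → 0 ≤ v k)
    (hZ0 : ∀ k, k ≤ -1 → phiMf a1 a2 (Z k) (idx (k + 1)) = 0) {k : ℤ} (hk : k ≤ 0) :
    0 ≤ u k ∧ epsP a1 a2 (Y k) (idx k) = 0 := by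
  have step : ∀ k : ℤ, k + 1 ≤ 0 → HasChainWt a1 a2 μ p Y Z (k + 1) →
      Reach a1 a2 μ (combine (Y 0) (Z 0)) (combine (Y (k + 1)) (Z (k + 1))) →
      0 ≤ u (k + 1) ∧ epsP a1 a2 (Y (k + 1)) (idx (k + 1)) = 0 := by
    intro k hk hw hr
    have h1 := (hext.of_reach hr (isI_idx (k + 1))).1
    have h2 := h.pos (k + 1)
    have h3 := h.sum (k + 1)
    rw [eZ_eq_none_iff (h.chainP.fin _) (h.chainM.fin _) (isI_idx _), hw.2,
      h.chainM.phiMf_eq (hv _ (by omega)) (hZ0 _ (by omega))] at h1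
    obtain ⟨h4, h5⟩ := h1 (by omega)
    exact ⟨by omega, le_antisymm h4 (epsP_nonneg a1 a2 (h.chainP.fin _) (isI_idx _))⟩
  have key : ∀ n : ℕ, HasChainWt a1 a2 μ p Y Z (-n) ∧
      Reach a1 a2 μ (combine (Y 0) (Z 0)) (combine (Y (-n)) (Z (-n))) := by
    intro n
    induction n with
    | zero => exact ⟨h.hasChainWt_zero, [], by simp, rfl⟩
    | succ n ih =>
      rw [show (-n : ℤ) = -(n + 1 : ℕ) + 1 by push_cast; ring] at ih
      obtain ⟨h1, h2⟩ := step _ (by omega) ih.1 ih.2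
      have hw := (h.hasChainWt_succ_iff h1 (hv _ (by omega))).1 ih.1
      exact ⟨hw, ih.2.step (isI_idx _)
        (h.SiO_down h1 (hv _ (by omega)) h2 (hZ0 _ (by omega)) hw)⟩
  obtain ⟨h1, h2⟩ := key (-k).toNat
  rw [show -((-k).toNat : ℤ) = k - 1 + 1 by omega] at h1 h2
  have h3 := step (k - 1) (by omega) h1 h2
  rwa [sub_add_cancel] at h3

end Converse

end TwoChain

/-! ### The coordinates `u` and `v` -/

/-- `u_k = x_k` for `k ≥ 1` and `u_k = p_k + x_k` for `k ≤ 0`. -/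
def uCoord (p x : ℤ → ℤ) (k : ℤ) : ℤ := if 1 ≤ k then x k else p k + x k

/-- `v_k = p_k - x_k` for `k ≥ 1` and `v_k = -x_k` for `k ≤ 0`. -/
def vCoord (p x : ℤ → ℤ) (k : ℤ) : ℤ := if 1 ≤ k then p k - x k else -x k

lemma uCoord_of_pos (p x : ℤ → ℤ) {k : ℤ} (hk : 1 ≤ k) : uCoord p x k = x k := if_pos hk

lemma uCoord_of_nonpos (p x : ℤ → ℤ) {k : ℤ} (hk : k ≤ 0) : uCoord p x k = p k + x k :=
  if_neg (by omega)

lemma vCoord_of_pos (p x : ℤ → ℤ) {k : ℤ} (hk : 1 ≤ k) : vCoord p x k = p k - x k := if_pos hk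

lemma vCoord_of_nonpos (p x : ℤ → ℤ) {k : ℤ} (hk : k ≤ 0) : vCoord p x k = -x k :=
  if_neg (by omega)

lemma uCoord_add_vCoord (p x : ℤ → ℤ) (k : ℤ) : uCoord p x k + vCoord p x k = p k := by
  unfold uCoord vCoord; split_ifs <;> ring

lemma ZMem.uCoord_nonneg {x : ℤ → ℤ} (hx : ZMem x) (p : ℤ → ℤ) {k : ℤ} (hk : 1 ≤ k) :
    0 ≤ uCoord p x k := by
  have h := hx.1.2.1 k
  rw [posPart, if_pos hk] at h
  rwa [uCoord_of_pos p x hk]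

lemma ZMem.vCoord_nonneg {x : ℤ → ℤ} (hx : ZMem x) (p : ℤ → ℤ) {k : ℤ} (hk : k ≤ 0) :
    0 ≤ vCoord p x k := by
  have h := hx.2.2.1 k
  rw [negPart, if_pos hk] at h
  rw [vCoord_of_nonpos p x hk]
  omega

lemma sigmaCond_iff {a1 a2 k1 k2 : ℤ} {x : ℤ → ℤ} (hx : ZMem x) {u v : ℤ → ℤ}
    (hu : u = uCoord (pseq a1 a2 k1 k2) x) (hv : v = vCoord (pseq a1 a2 k1 k2) x) :
    SigmaCond a1 a2 k1 k2 x ↔ (∀ k, 0 ≤ u k) ∧ (∀ k, 0 ≤ v k) ∧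
      (∀ k, (u (k + 1) : ℝ) ≤ gammaR a1 a2 k * u k) ∧
      ∀ k, (v (k - 1) : ℝ) ≤ gammaR a1 a2 k * v k := by
  have hu0 : ∀ k, 1 ≤ k → 0 ≤ u k := fun k hk => hu ▸ hx.uCoord_nonneg _ hk
  have hv0 : ∀ k, k ≤ 0 → 0 ≤ v k := fun k hk => hv ▸ hx.vCoord_nonneg _ hk
  have hu1 : ∀ k, 1 ≤ k → u k = x k := fun k hk => hu ▸ uCoord_of_pos _ _ hk
  have hu2 : ∀ k, k ≤ 0 → u k = pseq a1 a2 k1 k2 k + x k := fun k hk => hu ▸ uCoord_of_nonpos _ _ hk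
  have hv1 : ∀ k, 1 ≤ k → v k = pseq a1 a2 k1 k2 k - x k := fun k hk => hv ▸ vCoord_of_pos _ _ hk
  have hv2 : ∀ k, k ≤ 0 → v k = -x k := fun k hk => hv ▸ vCoord_of_nonpos _ _ hk
  unfold SigmaCond
  constructor
  · rintro ⟨c1, c2, c3, c4, c5, c6, c7, c8⟩
    refine ⟨fun k => ?_, fun k => ?_, fun k => ?_, fun k => ?_⟩
    · rcases le_or_gt 1 k with hk | hk
      · exact hu0 k hk
      · rw [hu2 k (by omega)]; exact_mod_cast c6 k (by omega)
    · rcases le_or_gt 1 k with hk | hk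
      · rw [hv1 k hk]; exact_mod_cast c3 k hk
      · exact hv0 k (by omega)
    · rcases lt_trichotomy k 0 with hk | rfl | hk
      · have := c8 (k + 1) (by omega)
        rw [add_sub_cancel_right] at this
        rw [hu2 k (by omega), hu2 (k + 1) (by omega)]; push_cast; linarith
      · rw [hu2 0 le_rfl, hu1 (0 + 1) (by omega)]; push_cast; linarith
      · have := c4 k (by omega)
        rw [hu1 k (by omega), hu1 (k + 1) (by omega)]; linarith
    · rcases lt_trichotomy k 1 with hk | rfl | hk
      · have := c7 k (by omega)
        rw [hv2 k (by omega), hv2 (k - 1) (by omega)]; push_cast; linarith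
      · rw [hv1 1 le_rfl, hv2 (1 - 1) (by omega)]; push_cast; linarith
      · have := c5 (k - 1) (by omega)
        rw [sub_add_cancel] at this
        rw [hv1 k (by omega), hv1 (k - 1) (by omega)]; push_cast; linarith
  · rintro ⟨d1, d2, d3, d4⟩
    refine ⟨?_, ?_, fun k hk => ?_, fun k hk => ?_, fun k hk => ?_, fun k hk => ?_,
      fun k hk => ?_, fun k hk => ?_⟩
    · have := d3 0
      rw [hu2 0 le_rfl, hu1 (0 + 1) (by omega), zero_add] at this; push_cast at this; linarith
    · have := d4 1
      rw [hv1 1 le_rfl, hv2 (1 - 1) (by omega), sub_self] at this; push_cast at this; linarith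
    · have := d2 k
      rw [hv1 k hk] at this; exact_mod_cast this
    · have := d3 k
      rw [hu1 k (by omega), hu1 (k + 1) (by omega)] at this; linarith
    · have := d4 (k + 1)
      rw [add_sub_cancel_right, hv1 k (by omega), hv1 (k + 1) (by omega)] at this
      push_cast at this; linarith
    · have := d1 k
      rw [hu2 k hk] at this; exact_mod_cast this
    · have := d4 k
      rw [hv2 k (by omega), hv2 (k - 1) (by omega)] at this; push_cast at this; linarith
    · have := d3 (k - 1)
      rw [sub_add_cancel, hu2 k (by omega), hu2 (k - 1) (by omega)] at this
      push_cast at this; linarith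

lemma XXMem.zMem {a1 a2 : ℤ} {x : ℤ → ℤ} (h : XXMem a1 a2 x) : ZMem x := ⟨h.1.1, h.2.1⟩

lemma xxMem_of_gammaR {a1 a2 : ℤ} (ha1 : 1 ≤ a1) (ha2 : 1 ≤ a2) (ha : 4 < a1 * a2) {x : ℤ → ℤ}
    (hx : ZMem x) (hu : ∀ k, 1 ≤ k → (x (k + 1) : ℝ) ≤ gammaR a1 a2 k * x k)
    (hv : ∀ k, k ≤ 0 → gammaR a1 a2 k * x k ≤ x (k - 1)) : XXMem a1 a2 x := by
  refine ⟨⟨hx.1, fun j hj => ?_⟩, hx.2, fun j hj => ?_⟩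
  · have h0 : 0 ≤ x j := by have := hx.1.2.1 j; rwa [posPart, if_pos hj] at this
    have h := cc_ineq_of_gammaR_ineq ha1 ha2 ha (k := 1) (j - 1).toNat (s := x j) (t := x (j + 1)) h0
      (by rw [show 1 + ((j - 1).toNat : ℤ) = j by omega]; exact hu j hj)
    rw [cseq_eq_cc, cseq_eq_cc, posPart, if_pos hj, posPart, if_pos (by omega),
      show j.toNat = (j - 1).toNat + 1 by omega]
    linarith
  · have h0 : 0 ≤ -x j := by
      have := hx.2.2.1 j; rw [negPart, if_pos hj] at this; omega
    have h := cc_ineq_of_gammaR_ineq ha2 ha1 (by rwa [mul_comm]) (k := 1) (-j).toNat (s := -x j)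
      (t := -x (j - 1)) h0 (by
        rw [show 1 + ((-j).toNat : ℤ) = 1 - j by omega, gammaR_swap]
        have := hv j hj
        push_cast; linarith)
    rw [cseq'_eq_cseq, cseq'_eq_cseq, cseq_eq_cc, cseq_eq_cc, negPart, if_pos hj, negPart,
      if_pos (by omega), show (1 - j).toNat = (-j).toNat + 1 by omega]
    linarith

/-- The chains attached to `x`; at position `0` they give `x*`. -/
lemma exists_isTwoChain {a1 a2 k1 k2 : ℤ} {x : ℤ → ℤ} (hx : ZMem x)
    (hp : ∀ m, 0 < pseq a1 a2 k1 k2 m) :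
    ∃ Y Z, IsTwoChain a1 a2 (mustar a1 a2 (lamW k1 k2) x) (pseq a1 a2 k1 k2)
      (uCoord (pseq a1 a2 k1 k2) x) (vCoord (pseq a1 a2 k1 k2) x) Y Z ∧
      xstarFun a1 a2 x = combine (Y 0) (Z 0) := by
  set p := pseq a1 a2 k1 k2 with hpdef
  have hN : ∀ k : ℤ, (suppBoundP (posPart x) : ℤ) < k → posPart x k = 0 := Nat.sInf_mem hx.1.2.2
  have hM : ∀ k : ℤ, k < -(suppBoundM (negPart x) : ℤ) → negPart x k = 0 := Nat.sInf_mem hx.2.2.2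
  have hupos : ∀ k, 1 ≤ k → posPart x k = uCoord p x k := fun k hk => by
    rw [posPart, if_pos hk, uCoord_of_pos p x hk]
  have hvneg : ∀ k, k ≤ 0 → -negPart x k = vCoord p x k := fun k hk => by
    rw [negPart, if_pos hk, vCoord_of_nonpos p x hk]
  have hN' : ∀ k : ℤ, (suppBoundP (posPart x) : ℤ) < k → uCoord p x k = 0 := fun k hk => by
    rw [← hupos k (by omega), hN k hk]
  have hM' : ∀ k : ℤ, k < -(suppBoundM (negPart x) : ℤ) → vCoord p x k = 0 := fun k hk => by
    rw [← hvneg k (by omega), hM k hk, neg_zero]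
  obtain ⟨Y, hY, hY0⟩ := exists_isChainP a1 a2 hN'
  obtain ⟨Z, hZ, hZ0⟩ := exists_isChainM a1 a2 (v := vCoord p x)
    (N := -((suppBoundM (negPart x) + 1 : ℕ) : ℤ)) (fun k hk => hM' k (by push_cast at hk; omega))
  have hstarP : starP a1 a2 (posPart x) = Y 0 := by
    rw [starP, ← hY0 _ le_rfl]; exact hY.starPChain_eq hupos _
  have hstarM : starM a1 a2 (negPart x) = Z 0 := by
    rw [starM, ← hZ0 _ le_rfl]; exact hZ.starMChain_eq hvneg _
  have hwY : wtOf a1 a2 (Y 0) = wtOf a1 a2 (posPart x) := by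
    rw [hY.wtOf_eq (fun j hj => hx.uCoord_nonneg p (by omega)) hN']
    congr 1
    funext j
    split_ifs with hj
    · exact (hupos j (by omega)).symm
    · exact (if_neg (by omega)).symm
  have hwZ : wtOf a1 a2 (Z 0) = wtOf a1 a2 (negPart x) := by
    rw [hZ.wtOf_eq (fun j hj => hx.vCoord_nonneg p (by omega)) hM']
    congr 1
    funext j
    split_ifs with hj
    · rw [← hvneg j hj, neg_neg]
    · exact (if_neg hj).symm
  have hwt : wtZ a1 a2 (mustar a1 a2 (lamW k1 k2) x) (combine (Y 0) (Z 0)) = (-k1, k2) := by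
    rw [wtZ, wtOf_combine a1 a2 (hY.fin 0) (hZ.fin 0), hwY, hwZ, mustar]
    have : ((-k1, k2) : ℤ × ℤ) = -lamW k1 k2 := by simp [lamW]
    rw [this]; abel
  refine ⟨Y, Z, ⟨hY, hZ, pseq_add_two a1 a2 k1 k2, hp, uCoord_add_vCoord p x, ?_, ?_⟩, ?_⟩
  · rw [hwt]; rfl
  · rw [hwt]; rfl
  · rw [xstarFun, hstarP, hstarM]

end HypCrystal

open HypCrystal in
theorem sigmaMem_eq_extremal_set
    (a1 a2 : ℤ) (ha1 : 1 ≤ a1) (ha2 : 1 ≤ a2) (ha : 4 < a1 * a2)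
    (k1 k2 : ℤ) (hk1 : 0 < k1) (hk2 : 0 < k2)
    (hreg : 2 ≤ a1 → 2 ≤ a2 →
      (k2 ≤ k1 ∧ k1 < (a1 - 1) * k2) ∨ (k1 < k2 ∧ k2 ≤ (a2 - 1) * k1))
    (hdeg1 : a1 = 1 → 2 * k1 ≤ k2 ∧ k2 ≤ (a2 - 2) * k1)
    (hdeg2 : a2 = 1 → 2 * k2 ≤ k1 ∧ k1 ≤ (a1 - 2) * k2) :
    ∀ x : ℤ → ℤ,
      SigmaMem a1 a2 k1 k2 x ↔
        (XXMem a1 a2 x ∧ Extremal a1 a2 (mustar a1 a2 (lamW k1 k2) x) (xstarFun a1 a2 x)) := by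
  have hp := pseq_pos ha1 ha2 ha hk1 hk2 hreg hdeg1 hdeg2
  intro x
  constructor
  · rintro ⟨hx, hcond⟩
    obtain ⟨Y, Z, h, hstar⟩ := exists_isTwoChain hx hp
    obtain ⟨hu, hv, hγu, hγv⟩ := (sigmaCond_iff hx rfl rfl).1 hcond
    refine ⟨xxMem_of_gammaR ha1 ha2 ha hx (fun k hk => ?_) (fun k hk => ?_), ?_⟩
    · have := hγu k
      rwa [uCoord_of_pos _ _ hk, uCoord_of_pos _ _ (by omega)] at this
    · have := hγv k
      rw [vCoord_of_nonpos _ _ hk, vCoord_of_nonpos _ _ (by omega)] at this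
      push_cast at this
      linarith
    · rw [hstar]
      exact h.extremal hu hv ((h.chainP.string_iff_gammaR ha1 ha2 ha hu).2 hγu)
        ((h.chainM.string_iff_gammaR ha1 ha2 ha hv).2 hγv)
  · rintro ⟨hxx, hext⟩
    have hx := hxx.zMem
    obtain ⟨Y, Z, h, hstar⟩ := exists_isTwoChain hx hp
    rw [hstar] at hext
    have hu0 := fun k (hk : (1 : ℤ) ≤ k) => hx.uCoord_nonneg (pseq a1 a2 k1 k2) hk
    have hv0 := fun k (hk : k ≤ (0 : ℤ)) => hx.vCoord_nonneg (pseq a1 a2 k1 k2) hk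
    have hY0 := h.chainP.string_of_cseq ha1 ha2 ha hu0 fun j hj => by
      have := hxx.1.2 j hj
      rwa [HypCrystal.posPart, HypCrystal.posPart, if_pos hj, if_pos (by omega),
        ← uCoord_of_pos (pseq a1 a2 k1 k2) x hj,
        ← uCoord_of_pos (pseq a1 a2 k1 k2) x (by omega)] at this
    have hZ0 := h.chainM.string_of_cseq ha1 ha2 ha hv0 fun j hj => by
      have := hxx.2.2 j hj
      rw [HypCrystal.negPart, HypCrystal.negPart, if_pos hj, if_pos (by omega)] at this
      rw [vCoord_of_nonpos _ _ hj, vCoord_of_nonpos _ _ (by omega)]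
      linarith
    have hup := fun k (hk : (0 : ℤ) ≤ k) => h.string_up hext hu0 hY0 hk
    have hdown := fun k (hk : k ≤ (0 : ℤ)) => h.string_down hext hv0 hZ0 hk
    have hu : ∀ k, 0 ≤ uCoord (pseq a1 a2 k1 k2) x k := fun k =>
      (le_or_gt 1 k).elim (hu0 k) fun hk => (hdown k (by omega)).1
    have hv : ∀ k, 0 ≤ vCoord (pseq a1 a2 k1 k2) x k := fun k =>
      (le_or_gt k 0).elim (hv0 k) fun hk => by
        have := (hup (k - 1) (by omega)).1
        rwa [sub_add_cancel] at this
    refine ⟨hx, (sigmaCond_iff hx rfl rfl).2 ⟨hu, hv, ?_, ?_⟩⟩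
    · exact (h.chainP.string_iff_gammaR ha1 ha2 ha hu).1 fun k =>
        (le_or_gt 1 k).elim (hY0 k) fun hk => (hdown k (by omega)).2
    · exact (h.chainM.string_iff_gammaR ha1 ha2 ha hv).1 fun k =>
        (le_or_gt 0 k).elim (fun hk => (hup k hk).2) fun hk => hZ0 k (by omega)
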